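/- arXiv:1202.3940 — 4 statements merged into one kernel-verified Lean document; each statement's English description precedes it below -/
import Mathlib

section
/- Let 𝔽 = ℝ and let h ∈ R* be a vertex model. Then for every k ∈ ℕ, the rank of the edge connection matrix M_{f_h,k} equals the dimension of the space (V^{⊗k})^{Stab(h)} of tensors fixed by every element of Stab(h). -/
/-!
Formalization framework for "Partition functions of vertex models /
edge connection matrices" (Regts–Draisma style).

Graphs and fragments are finite multigraphs (allowing multiple edges, loops
and circles); a `k`-fragment additionally has `k` labelled open ends.  We
encode a `k`-fragment by a number `nv` of internal vertices, a number `ne`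
of edges, and for each edge the multiset of its endpoints, each endpoint
being either an internal vertex (`Sum.inl`) or an open-end label
(`Sum.inr`).  Every edge has `2` endpoints (counted with multiplicity; a
loop at `v` lists `v` twice) or `0` endpoints (a circle), and every label
occurs exactly once in total (the open ends have degree one).
-/

open MvPolynomial

namespace VertexModels

noncomputable section

/-- A `k`-fragment. For `k = 0` this is a graph. -/
structure Fragment (k : ℕ) : Type where
  nv : ℕ
  ne : ℕ
  inc : Fin ne → Multiset (Fin nv ⊕ Fin k)
  card_inc : ∀ e, Multiset.card (inc e) = 2 ∨ Multiset.card (inc e) = 0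
  openEnd : ∀ j : Fin k, (∑ e, (inc e).count (Sum.inr j)) = 1

/-- A graph: a `0`-fragment. -/
abbrev Graph := Fragment 0

/-- The basic `k`-fragment `F_k`: one internal vertex joined to each of the
`k` open ends by a half edge. -/
def basicFragment (k : ℕ) : Fragment k where
  nv := 1
  ne := k
  inc := fun e => {Sum.inl 0, Sum.inr e}
  card_inc := fun e => Or.inl (by simp)
  openEnd := fun j => by
    have h : ∀ e : Fin k,
        Multiset.count (Sum.inr j) ({Sum.inl 0, Sum.inr e} : Multiset (Fin 1 ⊕ Fin k))
          = if j = e then 1 else 0 := by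
      intro e
      by_cases he : j = e <;>
        simp [Multiset.count_cons, Multiset.count_singleton, he]
    simp only [h]
    simp

variable {𝔽 : Type} [Field 𝔽] {n : ℕ}

/-- A vertex model: a linear functional on `R = 𝔽[x_1, …, x_n]`. -/
abbrev VertexModel (𝔽 : Type) [Field 𝔽] (n : ℕ) : Type :=
  MvPolynomial (Fin n) 𝔽 →ₗ[𝔽] 𝔽

/-- The monomial `∏_{e ∈ δ(v)} x_{ψ(e)}` seen by the internal vertex `v` of a
fragment under the edge colouring `ψ`. -/
def monomialAt {k : ℕ} (F : Fragment k) (ψ : Fin F.ne → Fin n) (v : Fin F.nv) :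
    MvPolynomial (Fin n) 𝔽 :=
  ∏ e, (X (ψ e) : MvPolynomial (Fin n) 𝔽) ^ ((F.inc e).count (Sum.inl v))

/-- The partition function `f_h` of the vertex model `h`. -/
def partitionFun (h : VertexModel 𝔽 n) (G : Graph) : 𝔽 :=
  ∑ ψ : Fin G.ne → Fin n, ∏ v, h (monomialAt G ψ v)

/-- `h_φ(F)`, for a `k`-fragment `F` and a colouring `φ` of the open ends. -/
def hphi (h : VertexModel 𝔽 n) {k : ℕ} (F : Fragment k) (φ : Fin k → Fin n) : 𝔽 :=
  ∑ ψ ∈ Finset.univ.filter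
      (fun ψ : Fin F.ne → Fin n => ∀ (e : Fin F.ne) (j : Fin k),
        Sum.inr j ∈ F.inc e → ψ e = φ j),
    ∏ v, h (monomialAt F ψ v)

/-- `V^{⊗ k}` in coordinates: functions on multi-indices, with basis
`e_φ`. -/
abbrev Tensor (𝔽 : Type) [Field 𝔽] (n k : ℕ) : Type := (Fin k → Fin n) → 𝔽

/-- The tensor `p_h(F) = ∑_φ h_φ(F) e_φ ∈ V^{⊗ k}`. -/
def ph (h : VertexModel 𝔽 n) {k : ℕ} (F : Fragment k) : Tensor 𝔽 n k :=
  fun φ => hphi h F φ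

/-- The standard bilinear form on `V^{⊗ k}`. -/
def tpair {k : ℕ} (t s : Tensor 𝔽 n k) : 𝔽 := ∑ φ, t φ * s φ

/-- Tensor product `V^{⊗ k} × V^{⊗ l} → V^{⊗ (k+l)}`. -/
def tmul {k l : ℕ} (t : Tensor 𝔽 n k) (s : Tensor 𝔽 n l) : Tensor 𝔽 n (k + l) :=
  fun φ => t (fun i => φ (Fin.castAdd l i)) * s (fun i => φ (Fin.natAdd k i))

/-- The contraction `C^k_{i,j} : V^{⊗ k} → V^{⊗ (k-2)}` (here `k = m + 2`),
contracting the `i`-th and `j`-th tensor factors (`i < j`). -/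
def tcontract {m : ℕ} (i j : Fin (m + 2)) (t : Tensor 𝔽 n (m + 2)) : Tensor 𝔽 n m :=
  fun φ => ∑ c : Fin n,
    t (Fin.insertNth i c (Fin.insertNth (⟨j.1 - 1, by have := j.isLt; omega⟩ : Fin (m + 1)) c φ))

/-- The orthogonal group `O_n`, as the set of matrices `g` with `gᵀ g = 1`. -/
def orthSet (𝔽 : Type) [Field 𝔽] (n : ℕ) : Set (Matrix (Fin n) (Fin n) 𝔽) :=
  {g | g.transpose * g = 1}

/-- Substitution `X i ↦ ∑ j, g i j • X j`, i.e. composition of a polynomial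
with the linear map `g`, as a linear endomorphism of `R`. -/
noncomputable def polSub (g : Matrix (Fin n) (Fin n) 𝔽) :
    MvPolynomial (Fin n) 𝔽 →ₗ[𝔽] MvPolynomial (Fin n) 𝔽 :=
  (MvPolynomial.aeval (fun i => ∑ j, MvPolynomial.C (g i j) * X j)).toLinearMap

/-- The action of `g ∈ O_n` on vertex models: `(g h)(p) = h (p ∘ g) = h(g⁻¹ • p)`. -/
noncomputable def dualAct (g : Matrix (Fin n) (Fin n) 𝔽) (h : VertexModel 𝔽 n) :
    VertexModel 𝔽 n :=
  h.comp (polSub g)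

/-- The stabilizer `Stab(h) = {g ∈ O_n ∣ g h = h}`. -/
noncomputable def Stab (h : VertexModel 𝔽 n) : Set (Matrix (Fin n) (Fin n) 𝔽) :=
  {g | g ∈ orthSet 𝔽 n ∧ dualAct g h = h}

/-- The diagonal action of a matrix `g` on `V^{⊗ k}`. -/
def tact (g : Matrix (Fin n) (Fin n) 𝔽) (k : ℕ) :
    Tensor 𝔽 n k →ₗ[𝔽] Tensor 𝔽 n k :=
  Matrix.mulVecLin (Matrix.of fun φ ψ : Fin k → Fin n => ∏ i, g (φ i) (ψ i))

/-- The subspace `(V^{⊗ k})^S` of tensors fixed by every element of a set `S`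
of matrices. -/
def invSub (S : Set (Matrix (Fin n) (Fin n) 𝔽)) (k : ℕ) :
    Submodule 𝔽 (Tensor 𝔽 n k) where
  carrier := {t | ∀ g ∈ S, tact g k t = t}
  add_mem' := fun {a b} ha hb => by
    intro g hg
    rw [map_add, ha g hg, hb g hg]
  zero_mem' := by
    intro g hg
    rw [map_zero]
  smul_mem' := fun c a ha => by
    intro g hg
    rw [map_smul, ha g hg]

/-! ### Gluing two `k`-fragments into a graph -/

/-- `touches F H j a`: the edge `a` of the disjoint union of `F` and `H` is
incident with the open end labelled `j` (of its own fragment). -/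
def touches {k : ℕ} (F H : Fragment k) (j : Fin k) : Fin F.ne ⊕ Fin H.ne → Prop
  | .inl e => Sum.inr j ∈ F.inc e
  | .inr e => Sum.inr j ∈ H.inc e

/-- Edges of `F` and `H` which get merged into a single edge of `F * H` are
identified by the equivalence generated by sharing an open-end label. -/
def glueSetoid {k : ℕ} (F H : Fragment k) : Setoid (Fin F.ne ⊕ Fin H.ne) :=
  Relation.EqvGen.setoid (fun a b => ∃ j, touches F H j a ∧ touches F H j b)

/-- Number of edges of the glued graph `F * H`. -/
noncomputable def glueNE {k : ℕ} (F H : Fragment k) : ℕ :=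
  Nat.card (Quotient (glueSetoid F H))

noncomputable def glueEquiv {k : ℕ} (F H : Fragment k) :
    Fin (glueNE F H) ≃ Quotient (glueSetoid F H) :=
  (Finite.equivFin _).symm

/-- The internal (non-open-end) endpoints of an edge of the disjoint union,
re-indexed in `Fin (F.nv + H.nv)`. -/
def intEnds {k : ℕ} (F H : Fragment k) :
    Fin F.ne ⊕ Fin H.ne → Multiset (Fin (F.nv + H.nv) ⊕ Fin 0)
  | .inl e => (F.inc e).filterMap fun x =>
      match x with
      | .inl v => some (Sum.inl (Fin.castAdd H.nv v))
      | .inr _ => none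
  | .inr e => (H.inc e).filterMap fun x =>
      match x with
      | .inl v => some (Sum.inl (Fin.natAdd F.nv v))
      | .inr _ => none

/-- Endpoints of an edge of the glued graph: the internal endpoints of all
edges merged into it. -/
noncomputable def glueInc {k : ℕ} (F H : Fragment k) (c : Fin (glueNE F H)) :
    Multiset (Fin (F.nv + H.nv) ⊕ Fin 0) := by
  classical
  exact ∑ a ∈ Finset.univ.filter
    (fun a => Quotient.mk (glueSetoid F H) a = glueEquiv F H c), intEnds F H a

/-- The glued graph `F * H` of two `k`-fragments: connect the half edges
with equally labelled open ends into single edges (chains of half edges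
closing up produce circles).  (The impossible degenerate branch is never
taken.) -/
noncomputable def glue {k : ℕ} (F H : Fragment k) : Graph := by
  classical
  exact if hc : ∀ c, Multiset.card (glueInc F H c) = 2 ∨ Multiset.card (glueInc F H c) = 0 then
    { nv := F.nv + H.nv
      ne := glueNE F H
      inc := glueInc F H
      card_inc := hc
      openEnd := fun j => j.elim0 }
  else basicFragment 0

/-- The rank of the edge connection matrix `M_{f_h,k}` : the dimension of the
span of its rows. -/
noncomputable def connectionRank (h : VertexModel 𝔽 n) (k : ℕ) : ℕ :=
  Module.finrank 𝔽 (Submodule.span 𝔽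
    (Set.range fun F : Fragment k => fun H : Fragment k => partitionFun h (glue F H)))

/-! ### The algebra `𝒜` of formal linear combinations of fragments -/

/-- `p_h` on formal linear combinations `𝔽ℱ_k` of `k`-fragments. -/
noncomputable def phL (h : VertexModel 𝔽 n) (k : ℕ) :
    (Fragment k →₀ 𝔽) →ₗ[𝔽] Tensor 𝔽 n k :=
  Finsupp.linearCombination 𝔽 (fun F : Fragment k => ph h F)

/-- `γ ↦ (F ↦ f_h(γ * F))`: the bilinear extension of gluing followed by the
partition function.  Its kernel is `I_k`. -/
noncomputable def glueRow (h : VertexModel 𝔽 n) (k : ℕ) :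
    (Fragment k →₀ 𝔽) →ₗ[𝔽] (Fragment k → 𝔽) :=
  Finsupp.linearCombination 𝔽
    (fun F : Fragment k => fun H : Fragment k => partitionFun h (glue F H))

/-- A vertex model is nondegenerate if `ker p_h = I`. -/
def Nondeg (h : VertexModel 𝔽 n) : Prop :=
  ∀ (k : ℕ) (γ : Fragment k →₀ 𝔽), phL h k γ = 0 ↔ glueRow h k γ = 0

/-! ### The product of fragments and the contraction of fragments -/

/-- Endpoint multisets of the disjoint union `F H` of fragments (`H`'s open
ends relabelled by `i ↦ k + i`). -/
def mulInc {k l : ℕ} (F : Fragment k) (H : Fragment l) :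
    Fin (F.ne + H.ne) → Multiset (Fin (F.nv + H.nv) ⊕ Fin (k + l)) :=
  Fin.addCases
    (fun e => (F.inc e).map (Sum.map (Fin.castAdd H.nv) (Fin.castAdd l)))
    (fun e => (H.inc e).map (Sum.map (Fin.natAdd F.nv) (Fin.natAdd k)))

/-- The product `F H` in the fragment algebra `𝒜`: disjoint union, with the
open ends of `H` relabelled `i ↦ k + i`.  (The impossible degenerate branch
is never taken.) -/
noncomputable def fragMul {k l : ℕ} (F : Fragment k) (H : Fragment l) :
    Fragment (k + l) := by
  classical
  exact if hc : (∀ e, Multiset.card (mulInc F H e) = 2 ∨ Multiset.card (mulInc F H e) = 0)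
      ∧ (∀ j : Fin (k + l), (∑ e, (mulInc F H e).count (Sum.inr j)) = 1) then
    { nv := F.nv + H.nv
      ne := F.ne + H.ne
      inc := mulInc F H
      card_inc := hc.1
      openEnd := hc.2 }
  else basicFragment (k + l)

/-- Relabelling map for labels after removing labels `i` and `j` (`i < j`),
preserving the order of the remaining labels. -/
def downLabel {m : ℕ} (i j l : Fin (m + 2)) (hij : i < j) (h : ¬(l = i ∨ l = j)) : Fin m :=
  ⟨l.1 - (if i.1 < l.1 then 1 else 0) - (if j.1 < l.1 then 1 else 0), by
    push_neg at h
    have h1 : l.1 ≠ i.1 := fun hh => h.1 (Fin.ext hh)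
    have h2 : l.1 ≠ j.1 := fun hh => h.2 (Fin.ext hh)
    have h3 : i.1 < j.1 := hij
    have h4 := l.isLt
    have h6 := j.isLt
    split_ifs <;> omega⟩

/-- Removing the open ends `i` and `j` from an endpoint multiset and
relabelling the remaining open ends. -/
def removeEnd {m nv : ℕ} (i j : Fin (m + 2)) (hij : i < j) :
    Fin nv ⊕ Fin (m + 2) → Option (Fin nv ⊕ Fin m)
  | .inl v => some (.inl v)
  | .inr l => if h : l = i ∨ l = j then none else some (.inr (downLabel i j l hij h))

/-- Edges merged by the contraction `Γ^k_{i,j}`: those incident with the open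
end `i` or the open end `j`. -/
def contractSetoid {m : ℕ} (F : Fragment (m + 2)) (i j : Fin (m + 2)) :
    Setoid (Fin F.ne) :=
  Relation.EqvGen.setoid (fun e e' =>
    (Sum.inr i ∈ F.inc e ∨ Sum.inr j ∈ F.inc e) ∧
    (Sum.inr i ∈ F.inc e' ∨ Sum.inr j ∈ F.inc e'))

noncomputable def contractNE {m : ℕ} (F : Fragment (m + 2)) (i j : Fin (m + 2)) : ℕ :=
  Nat.card (Quotient (contractSetoid F i j))

noncomputable def contractEquiv {m : ℕ} (F : Fragment (m + 2)) (i j : Fin (m + 2)) :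
    Fin (contractNE F i j) ≃ Quotient (contractSetoid F i j) :=
  (Finite.equivFin _).symm

noncomputable def contractInc {m : ℕ} (F : Fragment (m + 2)) (i j : Fin (m + 2))
    (hij : i < j) (c : Fin (contractNE F i j)) : Multiset (Fin F.nv ⊕ Fin m) := by
  classical
  exact ∑ e ∈ Finset.univ.filter
    (fun e => Quotient.mk (contractSetoid F i j) e = contractEquiv F i j c),
    (F.inc e).filterMap (removeEnd i j hij)

/-- The contraction `Γ^k_{i,j}(F)` of a `(m+2)`-fragment: join the half edges
at the open ends labelled `i` and `j` into a single edge (possibly a circle)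
and relabel the remaining open ends preserving their order.  (The impossible
degenerate branch is never taken.) -/
noncomputable def fragContract {m : ℕ} (i j : Fin (m + 2)) (hij : i < j)
    (F : Fragment (m + 2)) : Fragment m := by
  classical
  exact if hc : (∀ c, Multiset.card (contractInc F i j hij c) = 2 ∨
        Multiset.card (contractInc F i j hij c) = 0)
      ∧ (∀ jj : Fin m, (∑ c, (contractInc F i j hij c).count (Sum.inr jj)) = 1) then
    { nv := F.nv
      ne := contractNE F i j
      inc := contractInc F i j hij
      card_inc := hc.1
      openEnd := hc.2 }
  else basicFragment m

/-! ### Zariski closedness, spin models, reductivity -/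

/-- A subset of a coordinate space `ι → 𝔽` is Zariski closed if it is the
common zero locus of a set of polynomials. -/
def IsZarClosed {ι : Type} (S : Set (ι → 𝔽)) : Prop :=
  ∃ P : Set (MvPolynomial ι 𝔽), S = {x | ∀ p ∈ P, MvPolynomial.eval x p = 0}

/-- The vertex model `h(p) = ∑ i, a i • p (u i)` attached to points
`u_1, …, u_m` and coefficients `a_1, …, a_m`. -/
noncomputable def spinModel {m : ℕ} (u : Fin m → (Fin n → 𝔽)) (a : Fin m → 𝔽) :
    VertexModel 𝔽 n :=
  ∑ i, a i • (MvPolynomial.aeval (u i) : MvPolynomial (Fin n) 𝔽 →ₐ[𝔽] 𝔽).toLinearMap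

/-- Multi-degrees of total degree at most `e`: coordinates for the space
`(R_{≤ e})^*`. -/
def LowDeg (n e : ℕ) : Type := {d : Fin n →₀ ℕ // (d.sum fun _ c => c) ≤ e}

/-- The `O_n`-orbit of `h_e` (the restriction of `h` to polynomials of degree
at most `e`), in coordinates. -/
noncomputable def restOrbit (h : VertexModel 𝔽 n) (e : ℕ) : Set (LowDeg n e → 𝔽) :=
  {y | ∃ g ∈ orthSet 𝔽 n, ∀ d : LowDeg n e,
    y d = dualAct g h (MvPolynomial.monomial d.1 (1 : 𝔽))}

/-- The `O_n`-orbit of an `m`-tuple of vectors, in coordinates. -/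
def vecOrbit {m : ℕ} (u : Fin m → (Fin n → 𝔽)) : Set (Fin m × Fin n → 𝔽) :=
  {y | ∃ g ∈ orthSet 𝔽 n, ∀ p : Fin m × Fin n, y p = g.mulVec (u p.1) p.2}

/-- The `O_n`-orbit of an element `w` of `⊕_{k ≤ e} V^{⊗ k}`, in
coordinates. -/
def tensorTupleOrbit (e : ℕ) (w : ∀ k : ℕ, Tensor 𝔽 n k) :
    Set ((Σ p : Fin (e + 1), (Fin p.1 → Fin n)) → 𝔽) :=
  {y | ∃ g ∈ orthSet 𝔽 n, ∀ q : Σ p : Fin (e + 1), (Fin p.1 → Fin n),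
    y q = tact g q.1 (w q.1) q.2}

/-- Linear reductivity of a set `H` of `n × n` matrices: in every
polynomial representation of `H`, every `H`-invariant subspace admits an
`H`-invariant complement. -/
def IsLinRed (H : Set (Matrix (Fin n) (Fin n) 𝔽)) : Prop :=
  ∀ (m : ℕ) (ρ : Matrix (Fin n) (Fin n) 𝔽 → Matrix (Fin m) (Fin m) 𝔽),
    (∀ a b : Fin m, ∃ p : MvPolynomial (Fin n × Fin n) 𝔽,
      ∀ g, ρ g a b = MvPolynomial.eval (fun q => g q.1 q.2) p) →
    (∀ g ∈ H, ∀ g' ∈ H, ρ (g * g') = ρ g * ρ g') → ρ 1 = 1 →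
    ∀ W : Submodule 𝔽 (Fin m → 𝔽),
      (∀ g ∈ H, ∀ w ∈ W, (ρ g).mulVec w ∈ W) →
      ∃ W' : Submodule 𝔽 (Fin m → 𝔽), IsCompl W W' ∧
        (∀ g ∈ H, ∀ w ∈ W', (ρ g).mulVec w ∈ W')

/-- The pointwise stabilizer in `O_n` of a graded family of subspaces of the
tensor algebra. -/
def setStab (A : ∀ k : ℕ, Submodule 𝔽 (Tensor 𝔽 n k)) :
    Set (Matrix (Fin n) (Fin n) 𝔽) :=
  {g | g ∈ orthSet 𝔽 n ∧ ∀ (k : ℕ), ∀ a ∈ A k, tact g k a = a}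

/-- The sum of the nontrivial `H`-isotypic components of `V^{⊗ k}`: the
largest `H`-stable subspace meeting the invariants trivially. -/
def nontrivialPart (H : Set (Matrix (Fin n) (Fin n) 𝔽)) (k : ℕ) :
    Submodule 𝔽 (Tensor 𝔽 n k) :=
  sSup {W | (∀ g ∈ H, ∀ w ∈ W, tact g k w ∈ W) ∧ W ⊓ invSub H k = ⊥}

end

end VertexModels

open VertexModels

namespace VertexModels

/-- Two functions on a finite type with equally many preimages of each value differ by a
permutation of the domain. -/
theorem exists_perm_of_sum_single_eq {P ι : Type} [Fintype P] {a b : P → ι}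
    (hab : ∑ p, Finsupp.single (a p) (1 : ℕ) = ∑ p, Finsupp.single (b p) 1) :
    ∃ σ : Equiv.Perm P, a = b ∘ σ := by
  classical
  have key : ∀ i, Nonempty ({p // a p = i} ≃ {p // b p = i}) := by
    intro i
    have h1 := DFunLike.congr_fun hab i
    simp only [Finsupp.finsetSum_apply, Finsupp.single_apply] at h1
    refine ⟨Fintype.equivOfCardEq ?_⟩
    rw [Fintype.card_subtype, Fintype.card_subtype, Finset.card_filter, Finset.card_filter]
    exact h1
  refine ⟨Equiv.ofFiberEquiv fun i => (key i).some, ?_⟩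
  ext p
  exact (Equiv.ofFiberEquiv_map _ p).symm

/-- Polarization: a symmetric coefficient family is determined by its homogeneous form. -/
theorem eq_zero_of_forall_sum_mul_prod_eq_zero {P ι : Type} [Fintype P] [Fintype ι]
    [DecidableEq P] (D : (P → ι) → ℝ) (hD : ∀ (σ : Equiv.Perm P) a, D (a ∘ σ) = D a)
    (h0 : ∀ y : ι → ℝ, ∑ a, D a * ∏ p, y (a p) = 0) : D = 0 := by
  classical
  set q : MvPolynomial ι ℝ :=
    ∑ a : P → ι, MvPolynomial.monomial (∑ p, Finsupp.single (a p) 1) (D a) with hq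
  have hq0 : q = 0 := by
    apply MvPolynomial.funext
    intro y
    rw [map_zero, ← h0 y, hq, map_sum]
    refine Finset.sum_congr rfl fun a _ => ?_
    rw [MvPolynomial.monomial_sum_index, map_mul, map_prod]
    simp [MvPolynomial.eval_monomial]
  funext a
  have hc := congrArg (MvPolynomial.coeff (∑ p, Finsupp.single (a p) 1)) hq0
  rw [hq, MvPolynomial.coeff_sum, MvPolynomial.coeff_zero] at hc
  simp only [MvPolynomial.coeff_monomial] at hc
  have h2 : ∀ b : P → ι, (if ∑ p, Finsupp.single (b p) 1 = ∑ p, Finsupp.single (a p) (1 : ℕ)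
      then D b else 0) = (if ∑ p, Finsupp.single (b p) 1 = ∑ p, Finsupp.single (a p) (1 : ℕ)
      then 1 else 0) * D a := by
    intro b
    split_ifs with hb
    · obtain ⟨σ, rfl⟩ := exists_perm_of_sum_single_eq hb
      rw [hD, one_mul]
    · rw [zero_mul]
  rw [Finset.sum_congr rfl fun b _ => h2 b, ← Finset.sum_mul] at hc
  rcases mul_eq_zero.1 hc with h3 | h3
  · exfalso
    have h4 := (Finset.sum_eq_zero_iff_of_nonneg (fun b _ => by split_ifs <;> norm_num)).1 h3 a
      (Finset.mem_univ a)
    simp at h4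
  · exact h3

open MeasureTheory in
/-- The moments of Lebesgue measure on a ball around the origin: up to a constant, the integral of
a product of coordinates counts the ways to pair off factors with equal coordinates. -/
theorem exists_setIntegral_ball_prod_eq (P ι : Type) [Fintype P] [Fintype ι]
    [DecidableEq P] [DecidableEq ι] (r : ℝ) :
    ∃ c : ℝ, ∀ a : P → ι,
      ∫ g : EuclideanSpace ℝ ι in Metric.closedBall 0 r, ∏ p, g (a p) =
        c * ∑ π : P ≃ Fin (Fintype.card P / 2) × Bool, ∑ θ : Fin (Fintype.card P / 2) → ι,
          if ∀ p, a p = θ (π p).1 then 1 else 0 := by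
  set N := Fintype.card P with hN
  set K : Set (EuclideanSpace ℝ ι) := Metric.closedBall 0 r with hK
  have hKc : IsCompact K := isCompact_closedBall 0 r
  set I : (P → ι) → ℝ := fun a => ∫ g : EuclideanSpace ℝ ι in K, ∏ p, g (a p) with hI
  set q : EuclideanSpace ℝ ι → ℝ := fun y => ∫ g : EuclideanSpace ℝ ι in K, (inner ℝ g y) ^ N
    with hq
  set J : (P → ι) → ℝ := fun a => ∑ π : P ≃ Fin (N / 2) × Bool, ∑ θ : Fin (N / 2) → ι,
          if ∀ p, a p = θ (π p).1 then 1 else 0 with hJ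
  have hIq : ∀ y : EuclideanSpace ℝ ι, ∑ a, I a * ∏ p, y (a p) = q y := by
    intro y
    have h1 : ∀ g : EuclideanSpace ℝ ι, (inner ℝ g y) ^ N =
        ∑ a : P → ι, (∏ p, g (a p)) * ∏ p, y (a p) := by
      intro g
      have : (inner ℝ g y : ℝ) ^ N = ∏ _p : P, ∑ i, g i * y i := by
        rw [Finset.prod_const, Finset.card_univ, ← hN, PiLp.inner_apply]
        simp [mul_comm]
      rw [this, Finset.prod_univ_sum, Fintype.piFinset_univ]
      simp only [Finset.prod_mul_distrib]
    simp only [hq, h1]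
    rw [integral_finsetSum]
    · refine Finset.sum_congr rfl fun a _ => ?_
      rw [integral_mul_const]
    · intro a _
      exact (Continuous.continuousOn (by fun_prop)).integrableOn_compact hKc
  have hq_inv : ∀ y y' : EuclideanSpace ℝ ι, ‖y‖ = ‖y'‖ → q y = q y' := by
    intro y y' hy
    obtain ⟨L, hL⟩ : ∃ L : EuclideanSpace ℝ ι ≃ₗᵢ[ℝ] EuclideanSpace ℝ ι, L y = y' :=
      ⟨_, Submodule.reflection_sub hy⟩
    have := (L.measurePreserving).setIntegral_preimage_emb
      L.toMeasurableEquiv.measurableEmbedding (fun g => (inner ℝ g y' : ℝ) ^ N) K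
    have hpre : (L : EuclideanSpace ℝ ι → EuclideanSpace ℝ ι) ⁻¹' K = K := by
      ext g; simp [hK]
    rw [hpre] at this
    simp only [hq]
    rw [← this, ← hL]
    simp only [LinearIsometryEquiv.inner_map_map]
  have hq_smul : ∀ (s : ℝ) y, q (s • y) = s ^ N * q y := by
    intro s y
    simp only [hq, inner_smul_right, mul_pow, integral_const_mul]
  have hJq : ∀ y : EuclideanSpace ℝ ι, ∑ a, J a * ∏ p, y (a p) =
      Fintype.card (P ≃ Fin (N / 2) × Bool) * (‖y‖ ^ 2) ^ (N / 2) := by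
    intro y
    have h1 : ∀ π : P ≃ Fin (N / 2) × Bool,
        ∑ a : P → ι, ∑ θ : Fin (N / 2) → ι, (if ∀ p, a p = θ (π p).1 then (1 : ℝ) else 0) *
          ∏ p, y (a p) = (‖y‖ ^ 2) ^ (N / 2) := by
      intro π
      rw [Finset.sum_comm]
      have h2 : ∀ θ : Fin (N / 2) → ι,
          ∑ a : P → ι, (if ∀ p, a p = θ (π p).1 then (1 : ℝ) else 0) * ∏ p, y (a p) =
            ∏ x, y (θ x) ^ 2 := by
        intro θ
        rw [Finset.sum_eq_single (fun p => θ (π p).1)]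
        · simp only [implies_true, if_true, one_mul]
          rw [Fintype.prod_equiv π (fun p => y (θ (π p).1)) (fun x => y (θ x.1)) fun _ => rfl,
            Fintype.prod_prod_type]
          simp [sq]
        · intro b _ hb
          rw [if_neg fun h => hb (funext h), zero_mul]
        · simp
      simp only [h2]
      rw [EuclideanSpace.norm_sq_eq]
      simp only [Real.norm_eq_abs, sq_abs]
      rw [← Fintype.card_fin (N / 2), ← Finset.card_univ, ← Finset.prod_const,
        Finset.prod_univ_sum, Fintype.piFinset_univ, Finset.card_univ, Fintype.card_fin]
    simp only [hJ, Finset.sum_mul]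
    rw [Finset.sum_comm]
    rw [Finset.sum_congr rfl fun π _ => h1 π, Finset.sum_const, Finset.card_univ, nsmul_eq_mul]
  obtain ⟨c, hc⟩ : ∃ c : ℝ, ∀ y, q y = c * ∑ a, J a * ∏ p, y (a p) := by
    rcases Nat.even_or_odd' N with ⟨m, hm | hm⟩
    · have hcard : (Fintype.card (P ≃ Fin (N / 2) × Bool) : ℝ) ≠ 0 := by
        have : Nonempty (P ≃ Fin (N / 2) × Bool) :=
          ⟨Fintype.equivOfCardEq (by simp [← hN]; omega)⟩
        exact_mod_cast Fintype.card_ne_zero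
      have hm2 : N / 2 = m := by omega
      suffices ∃ c : ℝ, ∀ y, q y = c * ‖y‖ ^ N by
        obtain ⟨c, hc⟩ := this
        refine ⟨c / Fintype.card (P ≃ Fin (N / 2) × Bool), fun y => ?_⟩
        rw [hm2] at hcard
        rw [hJq, hc, ← pow_mul, hm2, ← hm]
        field_simp
      by_cases hy0 : ∃ y0 : EuclideanSpace ℝ ι, y0 ≠ 0
      · obtain ⟨y0, hy0⟩ := hy0
        have hn : ‖y0‖ ≠ 0 := norm_ne_zero_iff.2 hy0
        refine ⟨q y0 / ‖y0‖ ^ N, fun y => ?_⟩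
        have := hq_inv (‖y0‖ • y) (‖y‖ • y0) (by simp [norm_smul, mul_comm])
        rw [hq_smul, hq_smul] at this
        field_simp
        linarith
      · push Not at hy0
        refine ⟨q 0, fun y => ?_⟩
        rw [hy0 y]
        by_cases hN0 : N = 0
        · simp [hN0]
        · have := hq_smul 0 0
          rw [smul_zero, zero_pow hN0, zero_mul] at this
          simp [this]
    · refine ⟨0, fun y => ?_⟩
      have h1 := hq_smul (-1) y
      rw [hq_inv (-1 • y) y (by simp)] at h1
      rw [hm] at h1
      simp [pow_succ, pow_mul] at h1
      linarith
  refine ⟨c, fun a => ?_⟩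
  have hD := eq_zero_of_forall_sum_mul_prod_eq_zero (fun a => I a - c * J a) ?_ ?_
  · exact sub_eq_zero.1 (congrFun hD a)
  · intro σ a
    have h1 : I (a ∘ σ) = I a := by
      simp only [hI, Function.comp]
      congr 1
      ext g
      exact Equiv.prod_comp σ fun p => g (a p)
    have h2 : J (a ∘ σ) = J a := by
      simp only [hJ]
      refine Fintype.sum_equiv (σ.equivCongr (Equiv.refl _)) _ _ fun π => ?_
      refine Finset.sum_congr rfl fun θ _ => ?_
      congr 1
      refine propext (σ.forall_congr fun p => ?_)
      simp
    simp only [h1, h2]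
  · intro y
    have := hc (WithLp.toLp 2 y)
    rw [← hIq] at this
    simp only [sub_mul, Finset.sum_sub_distrib, mul_assoc, ← Finset.mul_sum]
    exact sub_eq_zero.2 this

/-- A form of the Stone–Weierstrass theorem without separation of points: a continuous function
that only depends on the values of a family `s` can be approximated on compact sets by elements of
the algebra generated by `s`. -/
theorem exists_mem_adjoin_abs_sub_lt {Y : Type*} [TopologicalSpace Y] {K : Set Y}
    (hK : IsCompact K) (s : Set C(Y, ℝ)) (f : C(Y, ℝ))
    (hf : ∀ x y, (∀ c ∈ s, c x = c y) → f x = f y) {ε : ℝ} (hε : 0 < ε) :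
    ∃ p ∈ Algebra.adjoin ℝ s, ∀ x ∈ K, |f x - p x| < ε := by
  let S : Setoid K := ⟨fun x y => ∀ c ∈ s, c x = c y,
    ⟨fun _ _ _ => rfl, fun h c hc => (h c hc).symm,
      fun h h' c hc => (h c hc).trans (h' c hc)⟩⟩
  have : CompactSpace K := isCompact_iff_compactSpace.1 hK
  let res : C(Y, ℝ) →ₐ[ℝ] C(K, ℝ) := ContinuousMap.compRightAlgHom ℝ ℝ ⟨Subtype.val, by fun_prop⟩
  let pull : C(Quotient S, ℝ) →ₐ[ℝ] C(K, ℝ) :=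
    ContinuousMap.compRightAlgHom ℝ ℝ ⟨Quotient.mk S, continuous_quot_mk⟩
  have hlift : ∀ c : C(Y, ℝ), (∀ x y : K, S x y → c x = c y) →
      ∃ c' : C(Quotient S, ℝ), pull c' = res c := fun c hc =>
    ⟨⟨Quotient.lift (fun x : K => c x) hc,
      Continuous.quotient_lift (by fun_prop) hc⟩, by ext; rfl⟩
  let B : Subalgebra ℝ C(Quotient S, ℝ) := ((Algebra.adjoin ℝ s).map res).comap pull
  have hB : B.SeparatesPoints := by
    rintro ⟨x⟩ ⟨y⟩ hxy
    have hxy' : ¬ ∀ c ∈ s, c x = c y := fun h => hxy (Quotient.sound h)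
    push Not at hxy'
    obtain ⟨c, hc, hne⟩ := hxy'
    obtain ⟨c', hc'⟩ := hlift c fun x y h => h c hc
    refine ⟨c', ⟨c', ?_, rfl⟩, ?_⟩
    · exact ⟨c, Algebra.subset_adjoin hc, hc'.symm⟩
    · intro h
      apply hne
      have h1 := DFunLike.congr_fun hc' x
      have h2 := DFunLike.congr_fun hc' y
      exact h1.symm.trans (h.trans h2)
  obtain ⟨f', hf'⟩ := hlift f fun x y h => hf x y h
  obtain ⟨⟨p', p, hp, hpp'⟩, hlt⟩ :=
    ContinuousMap.exists_mem_subalgebra_near_continuousMap_of_separatesPoints B hB f' ε hε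
  refine ⟨p, hp, fun x hx => ?_⟩
  have h1 := (ContinuousMap.norm_coe_le_norm _ (Quotient.mk S ⟨x, hx⟩)).trans_lt hlt
  have h2 : f' (Quotient.mk S ⟨x, hx⟩) = f x := DFunLike.congr_fun hf' ⟨x, hx⟩
  have h3 : p x = p' (Quotient.mk S ⟨x, hx⟩) := DFunLike.congr_fun hpp' ⟨x, hx⟩
  rw [← h2, h3, abs_sub_comm]
  exact h1

open MeasureTheory in
/-- If `F` is orthogonal on a compact set to the algebra generated by `s`, it is orthogonal to every
continuous function that only depends on the values of `s`. -/
theorem setIntegral_mul_eq_zero_of_adjoin {Y : Type*} [TopologicalSpace Y] [T2Space Y]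
    [MeasurableSpace Y] [OpensMeasurableSpace Y] {μ : Measure Y} [IsFiniteMeasureOnCompacts μ]
    {K : Set Y} (hK : IsCompact K) (s : Set C(Y, ℝ)) (F f : C(Y, ℝ))
    (hf : ∀ x y, (∀ c ∈ s, c x = c y) → f x = f y)
    (hF : ∀ p ∈ Algebra.adjoin ℝ s, ∫ x in K, F x * p x ∂μ = 0) :
    ∫ x in K, F x * f x ∂μ = 0 := by
  have hInt : ∀ g : C(Y, ℝ), IntegrableOn (fun x => F x * g x) K μ := fun g =>
    (Continuous.continuousOn (by fun_prop)).integrableOn_compact hK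
  have hFint : IntegrableOn (fun x => |F x|) K μ :=
    (Continuous.continuousOn (by fun_prop)).integrableOn_compact hK
  set C := ∫ x in K, |F x| ∂μ with hC
  have hbound : ∀ ε > 0, |∫ x in K, F x * f x ∂μ| ≤ ε * C := by
    intro ε hε
    obtain ⟨p, hp, hpf⟩ := exists_mem_adjoin_abs_sub_lt hK s f hf hε
    have h1 : ∫ x in K, F x * f x ∂μ = ∫ x in K, F x * (f - p) x ∂μ := by
      rw [← sub_zero (∫ x in K, F x * f x ∂μ), ← hF p hp, ← integral_sub (hInt f) (hInt p)]
      simp [mul_sub]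
    rw [h1, hC, ← integral_const_mul]
    refine abs_integral_le_integral_abs.trans ?_
    refine setIntegral_mono_on (hInt _).abs (hFint.const_mul ε) hK.measurableSet fun x hx => ?_
    rw [abs_mul, mul_comm]
    exact mul_le_mul_of_nonneg_right (hpf x hx).le (abs_nonneg _)
  have hC0 : 0 ≤ C := integral_nonneg fun _ => abs_nonneg _
  have : |∫ x in K, F x * f x ∂μ| ≤ 0 := by
    refine le_of_forall_pos_le_add fun ε hε => ?_
    refine (hbound (ε / (C + 1)) (by positivity)).trans ?_
    rw [div_mul_eq_mul_div, div_le_iff₀ (by positivity)]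
    nlinarith
  exact abs_nonpos_iff.1 this

/-- Merging edges along links: if every edge has two or no ends, some of them linked in pairs,
then every class of edges connected by links has two or no unlinked ends. -/
theorem sum_class_eq_two_or_zero {E L : Type} [Fintype E] [Fintype L] [DecidableEq E]
    (a b : L → E) (s : Setoid E) [DecidableEq (Quotient s)]
    (hs : ∀ x y, s x y ↔ Relation.EqvGen (fun x y => ∃ l, x = a l ∧ y = b l) x y)
    (d : E → ℕ)
    (hd : ∀ e, d e + (Finset.univ.filter fun l => a l = e).card +
        (Finset.univ.filter fun l => b l = e).card = 2 ∨
      d e + (Finset.univ.filter fun l => a l = e).card +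
        (Finset.univ.filter fun l => b l = e).card = 0)
    (c : Quotient s) :
    ∑ e with Quotient.mk s e = c, d e = 2 ∨ ∑ e with Quotient.mk s e = c, d e = 0 := by
  classical
  have hab : ∀ l, Quotient.mk s (a l) = Quotient.mk s (b l) := fun l =>
    Quotient.sound ((hs _ _).2 (.rel _ _ ⟨l, rfl, rfl⟩))
  set C := Finset.univ.filter fun e => Quotient.mk s e = c with hC
  set Lc := Finset.univ.filter fun l => Quotient.mk s (a l) = c with hLc
  have ha : ∑ e ∈ C, (Finset.univ.filter fun l => a l = e).card = Lc.card := by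
    rw [Finset.card_eq_sum_card_fiberwise (f := a) (t := C)]
    · refine Finset.sum_congr rfl fun e he => ?_
      congr 1
      ext l
      simp only [Finset.mem_filter, Finset.mem_univ, true_and, hLc, hC] at he ⊢
      exact ⟨fun h => ⟨h ▸ he, h⟩, fun h => h.2⟩
    · intro l hl
      simpa [hLc, hC] using hl
  have hb : ∑ e ∈ C, (Finset.univ.filter fun l => b l = e).card = Lc.card := by
    rw [Finset.card_eq_sum_card_fiberwise (f := b) (t := C)]
    · refine Finset.sum_congr rfl fun e he => ?_
      congr 1
      ext l
      simp only [Finset.mem_filter, Finset.mem_univ, true_and, hLc, hC] at he ⊢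
      exact ⟨fun h => ⟨by rw [hab, h, he], h⟩, fun h => h.2⟩
    · intro l hl
      simpa [hLc, hC, hab] using hl
  have hcard : C.card ≤ Lc.card + 1 := by
    let V := {e // Quotient.mk s e = c}
    let G : SimpleGraph V := SimpleGraph.fromRel fun x y => ∃ l, x.1 = a l ∧ y.1 = b l
    have hreach : ∀ x y, Relation.EqvGen (fun x y => ∃ l, x = a l ∧ y = b l) x y →
        ∀ (hx : Quotient.mk s x = c) (hy : Quotient.mk s y = c),
          G.Reachable ⟨x, hx⟩ ⟨y, hy⟩ := by
      intro x y h
      induction h with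
      | rel x y h =>
        intro hx hy
        by_cases hxy : x = y
        · subst hxy; rfl
        · exact SimpleGraph.Adj.reachable ⟨fun h' => hxy (congrArg Subtype.val h'), Or.inl h⟩
      | refl x => intro _ _; rfl
      | symm x y _ ih => intro hx hy; exact (ih hy hx).symm
      | trans x y z hxy _ ih1 ih2 =>
        intro hx hz
        have hy : Quotient.mk s y = c := by rw [← hx]; exact (Quotient.sound ((hs _ _).2 hxy)).symm
        exact (ih1 hx hy).trans (ih2 hy hz)
    have hconn : G.Connected := by
      obtain ⟨e, he⟩ := Quotient.exists_rep c
      have : Nonempty V := ⟨⟨e, he⟩⟩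
      exact ⟨fun x y => hreach x.1 y.1
        ((hs _ _).1 (Quotient.exact (x.2.trans y.2.symm))) x.2 y.2⟩
    have h1 := hconn.card_vert_le_card_edgeSet_add_one
    let edge : {l // Quotient.mk s (a l) = c} → Sym2 V := fun l =>
      s(⟨a l.1, l.2⟩, ⟨b l.1, (hab l.1).symm.trans l.2⟩)
    have hsub : G.edgeSet ⊆ Set.range edge := by
      intro z
      induction z using Sym2.ind with
      | _ x y =>
        rintro ⟨-, ⟨l, hx, hy⟩ | ⟨l, hx, hy⟩⟩
        · refine ⟨⟨l, hx ▸ x.2⟩, ?_⟩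
          simp only [edge, Sym2.eq_iff]
          exact Or.inl ⟨Subtype.ext hx.symm, Subtype.ext hy.symm⟩
        · refine ⟨⟨l, hx ▸ y.2⟩, ?_⟩
          simp only [edge, Sym2.eq_iff]
          exact Or.inr ⟨Subtype.ext hx.symm, Subtype.ext hy.symm⟩
    have h2 : Nat.card G.edgeSet ≤ Nat.card (Set.range edge) :=
      Nat.card_mono (Set.toFinite _) hsub
    have h3 : Nat.card (Set.range edge) ≤ Nat.card {l // Quotient.mk s (a l) = c} :=
      Finite.card_range_le edge
    have h4 : Nat.card V = C.card := by
      rw [Nat.card_eq_fintype_card, Fintype.card_subtype]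
    have h5 : Nat.card {l // Quotient.mk s (a l) = c} = Lc.card := by
      rw [Nat.card_eq_fintype_card, Fintype.card_subtype]
    omega
  have hle : ∑ e ∈ C, (d e + (Finset.univ.filter fun l => a l = e).card +
      (Finset.univ.filter fun l => b l = e).card) ≤ C.card * 2 := by
    rw [← smul_eq_mul]
    exact Finset.sum_le_card_nsmul _ _ _ fun e _ => by rcases hd e with h | h <;> omega
  have heven : 2 ∣ ∑ e ∈ C, (d e + (Finset.univ.filter fun l => a l = e).card +
      (Finset.univ.filter fun l => b l = e).card) :=
    Finset.dvd_sum fun e _ => by rcases hd e with h | h <;> omega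
  rw [Finset.sum_add_distrib, Finset.sum_add_distrib, ha, hb] at hle heven
  omega

/-- Functions on a type that are constant on the classes of a setoid are functions on the
quotient. -/
theorem sum_ite_respects_eq_sum_quotient {E α M : Type} [Fintype E] [DecidableEq E] [Fintype α]
    [AddCommMonoid M] (s : Setoid E) [Fintype (Quotient s)] [DecidableEq (Quotient s)]
    (p : (E → α) → Prop) [DecidablePred p] (hp : ∀ ψ, p ψ ↔ ∀ x y, s x y → ψ x = ψ y)
    (f : (E → α) → M) :
    ∑ ψ, (if p ψ then f ψ else 0) = ∑ θ : Quotient s → α, f fun e => θ (Quotient.mk s e) := by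
  rw [← Finset.sum_filter]
  symm
  refine Finset.sum_bij (fun θ _ e => θ (Quotient.mk s e)) ?_ ?_ ?_ ?_
  · intro θ _
    simp only [Finset.mem_filter, Finset.mem_univ, true_and, hp]
    exact fun x y h => congrArg θ (Quotient.sound h)
  · intro θ _ θ' _ h
    ext c
    induction c using Quotient.ind with
    | _ e => exact congrFun h e
  · intro ψ hψ
    simp only [Finset.mem_filter, Finset.mem_univ, true_and, hp] at hψ
    exact ⟨Quotient.lift ψ hψ, Finset.mem_univ _, rfl⟩
  · intro _ _
    rfl

theorem respects_eqvGen_iff {E α : Type} {s : Setoid E} {r : E → E → Prop}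
    (hs : ∀ x y, s x y ↔ Relation.EqvGen r x y) (ψ : E → α) :
    (∀ x y, s x y → ψ x = ψ y) ↔ ∀ x y, r x y → ψ x = ψ y := by
  refine ⟨fun h x y hr => h x y ((hs _ _).2 (.rel _ _ hr)), fun h x y hxy => ?_⟩
  have hxy' := (hs _ _).1 hxy
  clear hxy
  induction hxy' with
  | rel x y hr => exact h x y hr
  | refl x => rfl
  | symm x y _ ih => exact ih.symm
  | trans x y z _ _ ih1 ih2 => exact ih1.trans ih2

section

variable {𝔽 : Type} [Field 𝔽] {n : ℕ}

/-- The tensor of a network with edges `E`, vertices `X`, incidence multiplicities `m` and open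
ends attached to the edges `o j`. -/
noncomputable def netTensor (h : VertexModel 𝔽 n) {k : ℕ} {E X : Type} [Fintype E] [DecidableEq E]
    [Fintype X] (o : Fin k → E) (m : X → E → ℕ) : Tensor 𝔽 n k :=
  fun φ => ∑ ψ : E → Fin n,
    if ∀ j, ψ (o j) = φ j then
      ∏ v, h (∏ e, (MvPolynomial.X (ψ e) : MvPolynomial (Fin n) 𝔽) ^ m v e) else 0

theorem netTensor_reindex (h : VertexModel 𝔽 n) {k : ℕ} {E X E' X' : Type} [Fintype E]
    [DecidableEq E] [Fintype X] [Fintype E'] [DecidableEq E'] [Fintype X'] (eE : E ≃ E')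
    (eX : X ≃ X') (o : Fin k → E) (m : X → E → ℕ) :
    netTensor h (fun j => eE (o j)) (fun v e => m (eX.symm v) (eE.symm e)) = netTensor h o m := by
  funext φ
  refine Fintype.sum_equiv (Equiv.arrowCongr eE.symm (Equiv.refl _)) _ _ fun ψ => ?_
  simp only [Equiv.arrowCongr_apply, Equiv.coe_refl, Function.comp, Equiv.symm_symm, id]
  congr 1
  refine Fintype.prod_equiv eX.symm _ _ fun v => ?_
  congr 1
  refine Fintype.prod_equiv eE.symm _ _ fun e => ?_
  simp

/-- A network whose edges have two or no ends is represented by a fragment. -/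
theorem exists_ph_eq_netTensor (h : VertexModel 𝔽 n) {k : ℕ} {E X : Type} [Fintype E]
    [DecidableEq E] [Fintype X] (o : Fin k → E) (m : X → E → ℕ)
    (hm : ∀ e, ∑ v, m v e + (Finset.univ.filter fun j => o j = e).card = 2 ∨
      ∑ v, m v e + (Finset.univ.filter fun j => o j = e).card = 0) :
    ∃ F : Fragment k, ph h F = netTensor h o m := by
  let eE := Fintype.equivFin E
  let eX := Fintype.equivFin X
  let inc : Fin (Fintype.card E) → Multiset (Fin (Fintype.card X) ⊕ Fin k) := fun e =>
    ∑ v, Multiset.replicate (m (eX.symm v) (eE.symm e)) (Sum.inl v) +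
      (Finset.univ.filter fun j => o j = eE.symm e).val.map Sum.inr
  have hinl : ∀ e v, (inc e).count (Sum.inl v) = m (eX.symm v) (eE.symm e) := by
    intro e v
    simp only [inc, Multiset.count_add, Multiset.count_sum', Multiset.count_replicate,
      Sum.inl.injEq]
    rw [Multiset.count_eq_zero_of_notMem (by simp)]
    simp
  have hinr : ∀ e j, (inc e).count (Sum.inr j) = if o j = eE.symm e then 1 else 0 := by
    intro e j
    simp only [inc, Multiset.count_add, Multiset.count_sum', Multiset.count_replicate,
      reduceCtorEq, if_false, Finset.sum_const_zero, zero_add]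
    rw [Multiset.count_map_eq_count' _ _ Sum.inr_injective]
    rw [Multiset.count_eq_of_nodup (Finset.nodup _)]
    simp
  have hmem : ∀ e j, Sum.inr j ∈ inc e ↔ o j = eE.symm e := by
    intro e j
    rw [← Multiset.count_pos, hinr]
    split_ifs <;> simp_all
  let F : Fragment k :=
    { nv := Fintype.card X
      ne := Fintype.card E
      inc := inc
      card_inc := fun e => by
        have : (inc e).card = ∑ v, m v (eE.symm e) +
            (Finset.univ.filter fun j => o j = eE.symm e).card := by
          simp only [inc, Multiset.card_add, Multiset.card_sum, Multiset.card_replicate,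
            Multiset.card_map]
          congr 1
          exact Equiv.sum_comp eX.symm fun v => m v (eE.symm e)
        rw [this]
        exact hm _
      openEnd := fun j => by
        simp only [hinr]
        rw [Equiv.sum_comp eE.symm fun e => if o j = e then 1 else 0]
        simp }
  refine ⟨F, ?_⟩
  rw [← netTensor_reindex h eE eX]
  funext φ
  simp only [ph, hphi, netTensor, Finset.sum_filter]
  refine Finset.sum_congr rfl fun ψ _ => ?_
  have hiff : (∀ (e : Fin F.ne) (j : Fin k), Sum.inr j ∈ F.inc e → ψ e = φ j) ↔
      ∀ j, ψ (eE (o j)) = φ j := by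
    refine ⟨fun H j => H _ j ((hmem _ _).2 (by simp)), fun H e j hj => ?_⟩
    rw [← H j, (hmem _ _).1 hj, Equiv.apply_symm_apply]
  simp only [hiff]
  congr 1
  refine Finset.prod_congr rfl fun v _ => ?_
  congr 1
  refine Finset.prod_congr rfl fun e _ => ?_
  exact congrArg _ (hinl e v)

theorem prod_pow_quotient {E M : Type} [Fintype E] [CommMonoid M] (s : Setoid E)
    [Fintype (Quotient s)] [DecidableEq (Quotient s)] (x : Quotient s → M) (m : E → ℕ) :
    ∏ e, x (Quotient.mk s e) ^ m e = ∏ c, x c ^ ∑ e with Quotient.mk s e = c, m e := by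
  rw [← Finset.prod_fiberwise Finset.univ (Quotient.mk s)]
  refine Finset.prod_congr rfl fun c _ => ?_
  rw [← Finset.prod_pow_eq_pow_sum]
  refine Finset.prod_congr rfl fun e he => ?_
  rw [(Finset.mem_filter.1 he).2]

/-- Restricting the sum over edge colourings of a network to the ones constant on the classes of
a setoid amounts to merging the edges in each class. -/
theorem sum_ite_respects_eq_netTensor (h : VertexModel 𝔽 n) {k : ℕ} {E X : Type} [Fintype E]
    [DecidableEq E] [Fintype X] (o : Fin k → E) (m : X → E → ℕ) (s : Setoid E)
    [Fintype (Quotient s)] [DecidableEq (Quotient s)]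
    (p : (E → Fin n) → Prop) [DecidablePred p] (hp : ∀ ψ, p ψ ↔ ∀ x y, s x y → ψ x = ψ y)
    (φ : Fin k → Fin n) :
    ∑ ψ : E → Fin n, (if p ψ then if ∀ j, ψ (o j) = φ j then
        ∏ v, h (∏ e, (MvPolynomial.X (ψ e) : MvPolynomial (Fin n) 𝔽) ^ m v e) else 0 else 0) =
      netTensor h (fun j => Quotient.mk s (o j))
        (fun v c => ∑ e with Quotient.mk s e = c, m v e) φ := by
  rw [sum_ite_respects_eq_sum_quotient s p hp]
  simp only [netTensor, ← prod_pow_quotient s]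

end

section

variable {𝔽 : Type} [Field 𝔽] {n k : ℕ}

theorem Fragment.exists_openEdge (F : Fragment k) (j : Fin k) :
    ∃ e, ∀ e', (F.inc e').count (Sum.inr j) = if e = e' then 1 else 0 := by
  obtain ⟨e, -, he⟩ := Finset.exists_ne_zero_of_sum_ne_zero
    (F.openEnd j ▸ one_ne_zero : ∑ e, (F.inc e).count (Sum.inr j) ≠ 0)
  have hsum := F.openEnd j
  rw [← Finset.add_sum_erase _ _ (Finset.mem_univ e)] at hsum
  have h0 : ∑ e ∈ Finset.univ.erase e, (F.inc e).count (Sum.inr j) = 0 := by omega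
  refine ⟨e, fun e' => ?_⟩
  split_ifs with h
  · rw [← h]
    omega
  · exact Finset.sum_eq_zero_iff.1 h0 e' (by simpa using Ne.symm h)

/-- The edge of a fragment incident with a given open end. -/
noncomputable def Fragment.openEdge (F : Fragment k) (j : Fin k) : Fin F.ne :=
  (F.exists_openEdge j).choose

theorem Fragment.count_inr (F : Fragment k) (j : Fin k) (e : Fin F.ne) :
    (F.inc e).count (Sum.inr j) = if F.openEdge j = e then 1 else 0 :=
  (F.exists_openEdge j).choose_spec e

theorem Fragment.inr_mem_inc (F : Fragment k) (j : Fin k) (e : Fin F.ne) :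
    Sum.inr j ∈ F.inc e ↔ F.openEdge j = e := by
  rw [← Multiset.count_pos, F.count_inr]
  split_ifs <;> simp_all

theorem Fragment.degree_eq (F : Fragment k) (e : Fin F.ne) :
    ∑ v, (F.inc e).count (Sum.inl v) + (Finset.univ.filter fun j => F.openEdge j = e).card = 2 ∨
      ∑ v, (F.inc e).count (Sum.inl v) +
        (Finset.univ.filter fun j => F.openEdge j = e).card = 0 := by
  have : ∑ v, (F.inc e).count (Sum.inl v) +
      (Finset.univ.filter fun j => F.openEdge j = e).card = (F.inc e).card := by
    rw [← Multiset.sum_count_eq_card (s := Finset.univ) (fun a _ => Finset.mem_univ a),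
      Fintype.sum_sum_type, Finset.card_filter]
    simp only [F.count_inr]
  rw [this]
  exact F.card_inc e

theorem ph_eq_netTensor (h : VertexModel 𝔽 n) (F : Fragment k) :
    ph h F = netTensor h F.openEdge fun v e => (F.inc e).count (Sum.inl v) := by
  funext φ
  simp only [ph, hphi, netTensor, monomialAt, Finset.sum_filter, F.inr_mem_inc]
  refine Finset.sum_congr rfl fun ψ _ => ?_
  congr 1
  exact propext ⟨fun H j => H _ j rfl, fun H e j he => he ▸ H j⟩

theorem touches_iff (F H : Fragment k) (j : Fin k) (x : Fin F.ne ⊕ Fin H.ne) :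
    touches F H j x ↔ x = Sum.inl (F.openEdge j) ∨ x = Sum.inr (H.openEdge j) := by
  cases x with
  | inl e => simp [touches, F.inr_mem_inc, eq_comm]
  | inr e => simp [touches, H.inr_mem_inc, eq_comm]

theorem glueSetoid_iff (F H : Fragment k) (x y : Fin F.ne ⊕ Fin H.ne) :
    glueSetoid F H x y ↔ Relation.EqvGen
      (fun x y => ∃ j, x = Sum.inl (F.openEdge j) ∧ y = Sum.inr (H.openEdge j)) x y := by
  set r : Fin F.ne ⊕ Fin H.ne → Fin F.ne ⊕ Fin H.ne → Prop :=
    fun x y => ∃ j, x = Sum.inl (F.openEdge j) ∧ y = Sum.inr (H.openEdge j)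
  constructor
  · intro hxy
    refine Setoid.eqvGen_le (s := Relation.EqvGen.setoid r) ?_ hxy
    rintro x y ⟨j, hx, hy⟩
    have hj : r (Sum.inl (F.openEdge j)) (Sum.inr (H.openEdge j)) := ⟨j, rfl, rfl⟩
    rw [touches_iff] at hx hy
    rcases hx with rfl | rfl <;> rcases hy with rfl | rfl
    · exact .refl _
    · exact .rel _ _ hj
    · exact .symm _ _ (.rel _ _ hj)
    · exact .refl _
  · intro hxy
    refine Relation.EqvGen.mono ?_ _ _ hxy
    rintro x y ⟨j, rfl, rfl⟩
    exact ⟨j, (touches_iff ..).2 (Or.inl rfl), (touches_iff ..).2 (Or.inr rfl)⟩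

theorem count_intEnds (F H : Fragment k) (v : Fin (F.nv + H.nv)) (x : Fin F.ne ⊕ Fin H.ne) :
    (intEnds F H x).count (Sum.inl v) = Fin.addCases
      (fun v => Sum.elim (fun e => (F.inc e).count (Sum.inl v)) (fun _ => 0) x)
      (fun v => Sum.elim (fun _ => 0) (fun e => (H.inc e).count (Sum.inl v)) x) v := by
  refine Fin.addCases (fun v => ?_) (fun v => ?_) v <;> cases x with
  | inl e =>
    simp only [Fin.addCases_left, Fin.addCases_right, Sum.elim_inl, intEnds]
    induction F.inc e using Multiset.induction_on with
    | empty => simp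
    | cons a s ih =>
      cases a <;> simp [Multiset.count_cons, ih, Fin.ext_iff] <;> omega
  | inr e =>
    simp only [Fin.addCases_left, Fin.addCases_right, Sum.elim_inr, intEnds]
    induction H.inc e using Multiset.induction_on with
    | empty => simp
    | cons a s ih =>
      cases a <;> simp [Multiset.count_cons, ih, Fin.ext_iff] <;> omega

theorem card_intEnds (F H : Fragment k) (x : Fin F.ne ⊕ Fin H.ne) :
    (intEnds F H x).card = Sum.elim (fun e => ∑ v, (F.inc e).count (Sum.inl v))
      (fun e => ∑ v, (H.inc e).count (Sum.inl v)) x := by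
  rw [← Multiset.sum_count_eq_card (s := Finset.univ) (fun a _ => Finset.mem_univ a),
    Fintype.sum_sum_type]
  simp only [count_intEnds, Fin.sum_univ_add]
  cases x <;> simp

theorem card_glueInc (F H : Fragment k) (c : Fin (glueNE F H)) :
    (glueInc F H c).card = 2 ∨ (glueInc F H c).card = 0 := by
  classical
  rw [glueInc, Multiset.card_sum]
  convert sum_class_eq_two_or_zero (fun j => Sum.inl (F.openEdge j))
    (fun j => Sum.inr (H.openEdge j)) (glueSetoid F H) (glueSetoid_iff F H)
    (fun x => (intEnds F H x).card) ?_ (glueEquiv F H c)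
  intro x
  rw [card_intEnds]
  cases x with
  | inl e => simpa using F.degree_eq e
  | inr e => simpa using H.degree_eq e

/-- The partition function of a glued graph is the inner product of the tensors of its two
parts. -/
theorem partitionFun_glue (h : VertexModel 𝔽 n) (F H : Fragment k) :
    partitionFun h (glue F H) = tpair (ph h F) (ph h H) := by
  classical
  let _ : Fintype (Quotient (glueSetoid F H)) := Fintype.ofFinite _
  have h1 : partitionFun h (glue F H) = ∑ θ : Quotient (glueSetoid F H) → Fin n,
      ∏ v, h (∏ x, (MvPolynomial.X (θ (Quotient.mk _ x)) : MvPolynomial (Fin n) 𝔽) ^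
        (intEnds F H x).count (Sum.inl v)) := by
    rw [glue, dif_pos (card_glueInc F H)]
    refine Fintype.sum_equiv (Equiv.arrowCongr (glueEquiv F H) (Equiv.refl _)) _ _ fun ψ => ?_
    refine Finset.prod_congr rfl fun v _ => ?_
    rw [prod_pow_quotient (glueSetoid F H) (fun c => (MvPolynomial.X
      (Equiv.arrowCongr (glueEquiv F H) (Equiv.refl (Fin n)) ψ c) : MvPolynomial (Fin n) 𝔽))]
    simp only [monomialAt]
    congr 1
    refine Fintype.prod_equiv (glueEquiv F H) _ _ fun c => ?_
    simp only [Equiv.arrowCongr_apply, Equiv.coe_refl, Function.comp, id, Equiv.symm_apply_apply]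
    congr 1
    simp only [glueInc, Multiset.count_sum']
  rw [h1, ← sum_ite_respects_eq_sum_quotient (glueSetoid F H)
    (fun ψ => ∀ j, ψ (Sum.inl (F.openEdge j)) = ψ (Sum.inr (H.openEdge j)))
    (fun ψ => by
      rw [respects_eqvGen_iff (glueSetoid_iff F H)]
      exact ⟨by rintro h _ _ ⟨j, rfl, rfl⟩; exact h j, fun h j => h _ _ ⟨j, rfl, rfl⟩⟩)
    (fun ψ => ∏ v, h (∏ x, (MvPolynomial.X (ψ x) : MvPolynomial (Fin n) 𝔽) ^
        (intEnds F H x).count (Sum.inl v)))]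
  rw [Fintype.sum_equiv (Equiv.sumArrowEquivProdArrow (Fin F.ne) (Fin H.ne) (Fin n)) _
    (fun p : (Fin F.ne → Fin n) × (Fin H.ne → Fin n) =>
      if ∀ j, p.1 (F.openEdge j) = p.2 (H.openEdge j) then
        (∏ v, h (monomialAt F p.1 v)) * ∏ v, h (monomialAt H p.2 v) else 0),
    Fintype.sum_prod_type]
  · rw [tpair, ph_eq_netTensor, ph_eq_netTensor]
    simp only [netTensor, Finset.sum_mul_sum]
    conv_rhs => rw [Finset.sum_comm]
    refine Finset.sum_congr rfl fun ψ _ => ?_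
    conv_rhs => rw [Finset.sum_comm]
    refine Finset.sum_congr rfl fun ψ' _ => ?_
    rw [Finset.sum_eq_single (fun j => ψ (F.openEdge j))]
    · simp only [implies_true, if_true, mul_ite, mul_zero, monomialAt]
      congr 1
      exact propext ⟨fun h j => (h j).symm, fun h j => (h j).symm⟩
    · intro φ _ hφ
      rw [if_neg (fun h => hφ (funext fun j => (h j).symm)), zero_mul]
    · simp
  · intro ψ
    simp only [Fin.prod_univ_add, count_intEnds, Fintype.prod_sum_type, Equiv.sumArrowEquivProdArrow]
    congr 1
    simp [monomialAt]

end

section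

variable {n k : ℕ}

theorem tpair_eq_zero_of_mem_span (S : Set (Tensor ℝ n k)) (t : Tensor ℝ n k)
    (hS : ∀ s ∈ S, tpair t s = 0) : ∀ s ∈ Submodule.span ℝ S, tpair t s = 0 := by
  intro s hs
  have h : Submodule.span ℝ S ≤ LinearMap.ker (dotProductBilin ℝ ℝ t) :=
    Submodule.span_le.2 fun s hs => hS s hs
  exact h hs

/-- The edge connection matrix is a Gram matrix, so its rank is the dimension of the span of the
tensors of the fragments. -/
theorem connectionRank_eq_finrank_span (h : VertexModel ℝ n) (k : ℕ) :
    connectionRank h k = Module.finrank ℝ (Submodule.span ℝ (Set.range (ph h (k := k)))) := by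
  let Φ : Tensor ℝ n k →ₗ[ℝ] Fragment k → ℝ :=
    LinearMap.pi fun H => (dotProductBilin ℝ ℝ).flip (ph h H)
  have hΦ : ∀ t H, Φ t H = tpair t (ph h H) := fun _ _ => rfl
  set A := Submodule.span ℝ (Set.range (ph h (k := k))) with hA
  have hrow : Submodule.span ℝ (Set.range fun F : Fragment k => fun H : Fragment k =>
      partitionFun h (glue F H)) = LinearMap.range (Φ.domRestrict A) := by
    rw [LinearMap.range_domRestrict, hA, Submodule.map_span, ← Set.range_comp]
    congr 2
    funext F H
    rw [Function.comp_apply, hΦ, partitionFun_glue]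
  rw [connectionRank, hrow]
  refine LinearMap.finrank_range_of_inj ?_
  rw [← LinearMap.ker_eq_bot, LinearMap.ker_eq_bot']
  rintro ⟨t, ht⟩ h0
  refine Subtype.ext (dotProduct_self_eq_zero.1 (tpair_eq_zero_of_mem_span _ t ?_ t ht))
  rintro _ ⟨H, rfl⟩
  exact congrFun h0 H

/-- A subspace of a space of tensors whose orthogonal complement in that space is trivial has
full dimension. -/
theorem finrank_eq_of_forall_tpair_eq_zero {A B : Submodule ℝ (Tensor ℝ n k)} (hAB : A ≤ B)
    (hB : ∀ t ∈ B, (∀ s ∈ A, tpair t s = 0) → t = 0) :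
    Module.finrank ℝ A = Module.finrank ℝ B := by
  refine le_antisymm (Submodule.finrank_mono hAB) ?_
  rw [← Subspace.dual_finrank_eq (K := ℝ) (V := A)]
  refine LinearMap.finrank_le_finrank_of_injective
    (f := (dotProductBilin ℝ ℝ).compl₁₂ B.subtype A.subtype) ?_
  rw [← LinearMap.ker_eq_bot, LinearMap.ker_eq_bot']
  rintro ⟨t, ht⟩ h0
  exact Subtype.ext (hB t ht fun s hs => LinearMap.congr_fun h0 ⟨s, hs⟩)

end

section

variable {𝔽 : Type} [Field 𝔽] {n k : ℕ}

/-- The product over the edges of a fragment of the pairings of the vectors at its two ends. -/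
noncomputable def edgeProd {R : Type} [CommRing R] (F : Fragment k)
    (y : Fin F.nv ⊕ Fin k → Fin n → R) : R :=
  ∏ e, ∑ c, ((F.inc e).map fun a => y a c).prod

theorem mulVec_dotProduct_mulVec_of_transpose_mul {R : Type} [CommRing R]
    {G : Matrix (Fin n) (Fin n) R} (hG : G.transpose * G = 1) (x y : Fin n → R) :
    G.mulVec x ⬝ᵥ G.mulVec y = x ⬝ᵥ y := by
  rw [Matrix.dotProduct_mulVec, ← Matrix.mulVec_transpose, Matrix.mulVec_mulVec, hG,
    Matrix.one_mulVec]

theorem edgeProd_mulVec {R : Type} [CommRing R] (F : Fragment k)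
    {G : Matrix (Fin n) (Fin n) R} (hG : G.transpose * G = 1)
    (y : Fin F.nv ⊕ Fin k → Fin n → R) :
    edgeProd F (fun a => G.mulVec (y a)) = edgeProd F y := by
  refine Finset.prod_congr rfl fun e _ => ?_
  rcases F.card_inc e with h | h
  · obtain ⟨a, b, hab⟩ := Multiset.card_eq_two.1 h
    simpa [hab, dotProduct] using mulVec_dotProduct_mulVec_of_transpose_mul hG (y a) (y b)
  · rw [Multiset.card_eq_zero.1 h]
    simp

theorem edgeProd_eq_sum {R : Type} [CommRing R] (F : Fragment k)
    (y : Fin F.nv ⊕ Fin k → Fin n → R) :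
    edgeProd F y = ∑ ψ : Fin F.ne → Fin n,
      (∏ v, ∏ e, y (Sum.inl v) (ψ e) ^ (F.inc e).count (Sum.inl v)) *
        ∏ j, y (Sum.inr j) (ψ (F.openEdge j)) := by
  rw [edgeProd, Finset.prod_univ_sum, Fintype.piFinset_univ]
  refine Finset.sum_congr rfl fun ψ _ => ?_
  have : ∀ e, ((F.inc e).map fun a => y a (ψ e)).prod =
      ∏ a, y a (ψ e) ^ (F.inc e).count a := fun e => by
    rw [Finset.prod_multiset_map_count]
    refine Finset.prod_subset (Finset.subset_univ _) fun a _ ha => ?_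
    rw [Multiset.count_eq_zero_of_notMem (by simpa using ha), pow_zero]
  simp only [this]
  rw [Finset.prod_comm, Fintype.prod_sum_type]
  congr 1
  refine Finset.prod_congr rfl fun j _ => ?_
  simp [F.count_inr, pow_ite]

/-- The functional on polynomials in several sets of variables which applies a vertex model to
each set of variables. -/
noncomputable def powFunctional (h : VertexModel 𝔽 n) (m : ℕ) :
    MvPolynomial (Fin m × Fin n) 𝔽 →ₗ[𝔽] 𝔽 :=
  (MvPolynomial.basisMonomials (Fin m × Fin n) 𝔽).constr 𝔽 fun d =>
    ∏ v, h (MvPolynomial.monomial (d.comapDomain (Prod.mk v)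
      (Prod.mk_right_injective v).injOn) 1)

theorem powFunctional_monomial (h : VertexModel 𝔽 n) (m : ℕ) (d : Fin m × Fin n →₀ ℕ) :
    powFunctional h m (MvPolynomial.monomial d 1) =
      ∏ v, h (MvPolynomial.monomial (d.comapDomain (Prod.mk v)
        (Prod.mk_right_injective v).injOn) 1) := by
  have := (MvPolynomial.basisMonomials (Fin m × Fin n) 𝔽).constr_basis 𝔽 (fun d =>
    ∏ v, h (MvPolynomial.monomial (d.comapDomain (Prod.mk v)
      (Prod.mk_right_injective v).injOn) 1)) d
  rwa [MvPolynomial.coe_basisMonomials] at this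

theorem powFunctional_prod_rename (h : VertexModel 𝔽 n) (m : ℕ)
    (p : Fin m → MvPolynomial (Fin n) 𝔽) :
    powFunctional h m (∏ v, MvPolynomial.rename (Prod.mk v) (p v)) = ∏ v, h (p v) := by
  have key : (powFunctional h m).compMultilinearMap
      ((MultilinearMap.mkPiAlgebra 𝔽 (Fin m) (MvPolynomial (Fin m × Fin n) 𝔽)).compLinearMap
        fun v => (MvPolynomial.rename (Prod.mk v)).toLinearMap) =
      (MultilinearMap.mkPiAlgebra 𝔽 (Fin m) 𝔽).compLinearMap fun _ => h := by
    refine Module.Basis.ext_multilinear (fun _ => MvPolynomial.basisMonomials (Fin n) 𝔽)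
      fun d => ?_
    simp only [LinearMap.compMultilinearMap_apply, MultilinearMap.compLinearMap_apply,
      MultilinearMap.mkPiAlgebra_apply, MvPolynomial.coe_basisMonomials, AlgHom.toLinearMap_apply,
      MvPolynomial.rename_monomial]
    rw [← MvPolynomial.monomial_sum_one, powFunctional_monomial]
    refine Finset.prod_congr rfl fun v _ => ?_
    congr 3
    ext c
    rw [Finsupp.comapDomain_apply, Finsupp.finsetSum_apply]
    rw [Finset.sum_eq_single v]
    · exact Finsupp.mapDomain_apply (Prod.mk_right_injective v) _ _
    · intro w _ hw
      exact Finsupp.mapDomain_of_notMem_range _ _ (by rintro ⟨a, ha⟩; exact hw (congrArg Prod.fst ha))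
    · simp
  exact congrArg (fun f => f p) key

theorem tact_netTensor (g : Matrix (Fin n) (Fin n) 𝔽) (h : VertexModel 𝔽 n) {E X : Type}
    [Fintype E] [DecidableEq E] [Fintype X] (o : Fin k → E) (m : X → E → ℕ) (φ : Fin k → Fin n) :
    tact g k (netTensor h o m) φ = ∑ ψ : E → Fin n, (∏ j, g (φ j) (ψ (o j))) *
      ∏ v, h (∏ e, (MvPolynomial.X (ψ e) : MvPolynomial (Fin n) 𝔽) ^ m v e) := by
  simp only [tact, Matrix.mulVecLin_apply, Matrix.mulVec, dotProduct, Matrix.of_apply, netTensor,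
    Finset.mul_sum]
  rw [Finset.sum_comm]
  refine Finset.sum_congr rfl fun ψ _ => ?_
  rw [Finset.sum_eq_single fun j => ψ (o j)]
  · simp
  · intro χ _ hχ
    rw [if_neg fun H => hχ (funext fun j => (H j).symm), mul_zero]
  · simp

theorem tact_ph (h : VertexModel 𝔽 n) (F : Fragment k) {g : Matrix (Fin n) (Fin n) 𝔽}
    (hg : g ∈ Stab h) : tact g k (ph h F) = ph h F := by
  obtain ⟨hgo, hgh⟩ := hg
  have hG : (g.map (MvPolynomial.C (σ := Fin F.nv × Fin n))).transpose *
      g.map (MvPolynomial.C (σ := Fin F.nv × Fin n)) = 1 := by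
    rw [← Matrix.transpose_map, ← Matrix.map_mul, show g.transpose * g = 1 from hgo]
    exact Matrix.map_one _ (map_zero _) (map_one _)
  have hgg : g * g.transpose = 1 := mul_eq_one_comm.1 hgo
  funext φ
  let y : Fin F.nv ⊕ Fin k → Fin n → MvPolynomial (Fin F.nv × Fin n) 𝔽 :=
    Sum.elim (fun v c => MvPolynomial.X (v, c)) (fun j c => MvPolynomial.C (g (φ j) c))
  have h1 : tact g k (ph h F) φ = powFunctional h F.nv (edgeProd F y) := by
    rw [ph_eq_netTensor, tact_netTensor, edgeProd_eq_sum, map_sum]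
    refine Finset.sum_congr rfl fun ψ _ => ?_
    simp only [y, Sum.elim_inl, Sum.elim_inr]
    rw [← map_prod MvPolynomial.C, mul_comm _ (MvPolynomial.C _), MvPolynomial.C_mul', map_smul,
      smul_eq_mul, ← powFunctional_prod_rename]
    simp only [map_prod, map_pow, MvPolynomial.rename_X]
  rw [h1, ← edgeProd_mulVec F hG, edgeProd_eq_sum, map_sum, ph_eq_netTensor, netTensor]
  refine Finset.sum_congr rfl fun ψ _ => ?_
  have hl : ∀ v c, (g.map MvPolynomial.C).mulVec (y (Sum.inl v)) c =
      MvPolynomial.rename (Prod.mk v) (polSub g (MvPolynomial.X c)) := by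
    intro v c
    simp [Matrix.mulVec, dotProduct, y, polSub]
  have hr : ∀ j c, (g.map MvPolynomial.C).mulVec (y (Sum.inr j)) c =
      MvPolynomial.C (if c = φ j then 1 else 0) := by
    intro j c
    simp only [Matrix.mulVec, dotProduct, y, Sum.elim_inr, Matrix.map_apply, ← map_mul, ← map_sum]
    congr 1
    simpa [Matrix.mul_apply, Matrix.one_apply] using congrFun (congrFun hgg c) (φ j)
  simp only [hl, hr]
  rw [← map_prod MvPolynomial.C, mul_comm _ (MvPolynomial.C _), MvPolynomial.C_mul', map_smul,
    smul_eq_mul]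
  have hps : ∀ v, ∏ e, MvPolynomial.rename (Prod.mk v) (polSub g (MvPolynomial.X (ψ e))) ^
      (F.inc e).count (Sum.inl v) = MvPolynomial.rename (Prod.mk v) (polSub g
        (∏ e, (MvPolynomial.X (ψ e)) ^ (F.inc e).count (Sum.inl v))) := fun v => by
    simp only [polSub, AlgHom.toLinearMap_apply, map_prod, map_pow]
  simp only [hps, powFunctional_prod_rename]
  have hh : ∀ p, h (polSub g p) = h p := fun p => LinearMap.congr_fun hgh p
  simp only [hh]
  rw [Finset.prod_ite_zero]
  simp

theorem span_range_ph_le_invSub (h : VertexModel 𝔽 n) (k : ℕ) :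
    Submodule.span 𝔽 (Set.range (ph h (k := k))) ≤ invSub (Stab h) k := by
  refine Submodule.span_le.2 ?_
  rintro _ ⟨F, rfl⟩ g hg
  exact tact_ph h F hg

end

section

variable {n k : ℕ}

/-- Pairing the ends of a network, some of whose ends are linked, gives a fragment. -/
theorem exists_sum_pairing_eq_tpair {𝔽 : Type} [Field 𝔽] (h : VertexModel 𝔽 n) {X S Q : Type}
    [Fintype X] [Fintype S] [Fintype Q] [DecidableEq Q] (d : X → ℕ)
    (π : Fin k ⊕ (Σ v, Fin (d v)) ⊕ (S × Bool) → Q)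
    (hπ : ∀ q, (Finset.univ.filter fun p => π p = q).card = 2) :
    ∃ F : Fragment k, ∀ t : Tensor 𝔽 n k, ∑ θ : Q → Fin n,
      (if ∀ s, θ (π (.inr (.inr (s, false)))) = θ (π (.inr (.inr (s, true)))) then
        t (fun j => θ (π (.inl j))) * ∏ v, h (∏ l : Fin (d v),
          (MvPolynomial.X (θ (π (.inr (.inl ⟨v, l⟩)))) : MvPolynomial (Fin n) 𝔽)) else 0) =
      tpair t (ph h F) := by
  classical
  let r : Q → Q → Prop := fun x y =>
    ∃ s, x = π (.inr (.inr (s, false))) ∧ y = π (.inr (.inr (s, true)))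
  let σ : Setoid Q := Relation.EqvGen.setoid r
  have hσ : ∀ x y, σ x y ↔ Relation.EqvGen r x y := fun _ _ => Iff.rfl
  let _ : Fintype (Quotient σ) := Fintype.ofFinite _
  let o : Fin k → Q := fun j => π (.inl j)
  let m : X → Q → ℕ := fun v e =>
    (Finset.univ.filter fun l : Fin (d v) => π (.inr (.inl ⟨v, l⟩)) = e).card
  have hm : ∀ c : Quotient σ, ∑ v, ∑ e with Quotient.mk σ e = c, m v e +
      (Finset.univ.filter fun j => Quotient.mk σ (o j) = c).card = 2 ∨
      ∑ v, ∑ e with Quotient.mk σ e = c, m v e +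
      (Finset.univ.filter fun j => Quotient.mk σ (o j) = c).card = 0 := by
    intro c
    have hc : ∑ v, ∑ e with Quotient.mk σ e = c, m v e +
        (Finset.univ.filter fun j => Quotient.mk σ (o j) = c).card =
        ∑ e with Quotient.mk σ e = c, (∑ v, m v e +
          (Finset.univ.filter fun j => o j = e).card) := by
      rw [Finset.sum_add_distrib, Finset.sum_comm]
      congr 1
      rw [Finset.card_eq_sum_card_fiberwise (f := o)
        (t := Finset.univ.filter fun e => Quotient.mk σ e = c) (fun j hj => by simpa using hj)]
      refine Finset.sum_congr rfl fun e he => ?_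
      congr 1
      ext j
      simp only [Finset.mem_filter, Finset.mem_univ, true_and] at he ⊢
      exact ⟨fun h => h.2, fun h => ⟨by rw [h, he], h⟩⟩
    rw [hc]
    refine sum_class_eq_two_or_zero (fun s => π (.inr (.inr (s, false))))
      (fun s => π (.inr (.inr (s, true)))) σ hσ _ (fun e => Or.inl ?_) c
    rw [← hπ e]
    simp only [m, o, Finset.card_filter, Fintype.sum_sum_type, Fintype.sum_sigma,
      Fintype.sum_prod_type, Fintype.sum_bool, Finset.sum_add_distrib]
    ring
  obtain ⟨F, hF⟩ := exists_ph_eq_netTensor h (fun j => Quotient.mk σ (o j))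
    (fun v c => ∑ e with Quotient.mk σ e = c, m v e) hm
  refine ⟨F, fun t => ?_⟩
  rw [tpair, hF]
  simp only [← sum_ite_respects_eq_netTensor h o m σ
    (fun θ => ∀ s, θ (π (.inr (.inr (s, false)))) = θ (π (.inr (.inr (s, true)))))
    (fun θ => by
      rw [respects_eqvGen_iff hσ]
      exact ⟨by rintro h _ _ ⟨s, rfl, rfl⟩; exact h s, fun h s => h _ _ ⟨s, rfl, rfl⟩⟩),
    Finset.mul_sum]
  rw [Finset.sum_comm]
  refine Finset.sum_congr rfl fun θ _ => ?_
  have hprod : ∀ v, ∏ l : Fin (d v),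
      (MvPolynomial.X (θ (π (.inr (.inl ⟨v, l⟩)))) : MvPolynomial (Fin n) 𝔽) =
      ∏ e, (MvPolynomial.X (θ e) : MvPolynomial (Fin n) 𝔽) ^ m v e := by
    intro v
    rw [← Finset.prod_fiberwise Finset.univ fun l : Fin (d v) => π (.inr (.inl ⟨v, l⟩))]
    refine Finset.prod_congr rfl fun e _ => ?_
    rw [← Finset.prod_const]
    refine Finset.prod_congr rfl fun l hl => ?_
    rw [(Finset.mem_filter.1 hl).2]
  split_ifs
  · rw [Finset.sum_eq_single fun j => θ (o j)]
    · simp only [implies_true, if_true, hprod, o]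
    · intro φ _ hφ
      rw [if_neg fun H => hφ (funext fun j => (H j).symm), mul_zero]
    · simp
  · simp

/-- A word in the variables. -/
abbrev Word (n : ℕ) : Type := Σ d : ℕ, Fin d → Fin n

/-- The value of a vertex model, transformed by a matrix, at a word. -/
noncomputable def wordVal (h : VertexModel ℝ n) (w : Word n)
    (g : EuclideanSpace ℝ (Fin n × Fin n)) : ℝ :=
  ∑ χ : Fin w.1 → Fin n, (∏ l, g (w.2 l, χ l)) * h (∏ l, MvPolynomial.X (χ l))

/-- The inner product of two rows of a matrix. -/
noncomputable def rowPair (b : Bool → Fin n) (g : EuclideanSpace ℝ (Fin n × Fin n)) : ℝ :=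
  ∑ c : Fin n, g (b false, c) * g (b true, c)

/-- A coordinate of a tensor transformed by a matrix. -/
noncomputable def tensorVal (t : Tensor ℝ n k) (α : Fin k → Fin n)
    (g : EuclideanSpace ℝ (Fin n × Fin n)) : ℝ :=
  ∑ ψ : Fin k → Fin n, (∏ i, g (α i, ψ i)) * t ψ

theorem tensorVal_mul_prod_eq_sum (h : VertexModel ℝ n) (t : Tensor ℝ n k) (α : Fin k → Fin n)
    {X S : Type} [Fintype X] [Fintype S] [DecidableEq X] [DecidableEq S] (w : X → Word n)
    (b : S → Bool → Fin n)
    (g : EuclideanSpace ℝ (Fin n × Fin n)) :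
    tensorVal t α g * ((∏ v, wordVal h (w v) g) * ∏ s, rowPair (b s) g) =
      ∑ col : Fin k ⊕ (Σ v, Fin (w v).1) ⊕ (S × Bool) → Fin n,
        (if ∀ s, col (.inr (.inr (s, false))) = col (.inr (.inr (s, true))) then
          t (fun j => col (.inl j)) * ∏ v, h (∏ l : Fin (w v).1,
            (MvPolynomial.X (col (.inr (.inl ⟨v, l⟩))) : MvPolynomial (Fin n) ℝ)) else 0) *
        ∏ p, g (Sum.elim α (Sum.elim (fun q => (w q.1).2 q.2) (fun q => b q.1 q.2)) p, col p) := by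
  have h1 : ∏ v, wordVal h (w v) g = ∑ χ : (Σ v, Fin (w v).1) → Fin n,
      (∏ q, g ((w q.1).2 q.2, χ q)) * ∏ v, h (∏ l : Fin (w v).1, MvPolynomial.X (χ ⟨v, l⟩)) := by
    simp only [wordVal]
    rw [Finset.prod_univ_sum, Fintype.piFinset_univ]
    refine (Fintype.sum_equiv (Equiv.piCurry fun _ _ => Fin n) _ _ fun χ => ?_).symm
    rw [Fintype.prod_sigma, ← Finset.prod_mul_distrib]
    rfl
  have h2 : ∏ s, rowPair (b s) g = ∑ ρ : S × Bool → Fin n,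
      (if ∀ s, ρ (s, false) = ρ (s, true) then 1 else 0) * ∏ q, g (b q.1 q.2, ρ q) := by
    have : ∀ s, rowPair (b s) g = ∑ ρ : Bool → Fin n,
        (if ρ false = ρ true then 1 else 0) * ∏ q, g (b s q, ρ q) := by
      intro s
      rw [Fintype.sum_equiv (Equiv.boolArrowEquivProd (Fin n)) _
        (fun p => (if p.1 = p.2 then 1 else 0) * (g (b s false, p.1) * g (b s true, p.2)))]
      · simp [Fintype.sum_prod_type, rowPair]
      · intro ρ
        simp [mul_comm]
    simp only [this]
    rw [Finset.prod_univ_sum, Fintype.piFinset_univ]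
    refine (Fintype.sum_equiv (Equiv.curry S Bool (Fin n)) _ _ fun ρ => ?_).symm
    rw [Fintype.prod_prod_type, Finset.prod_mul_distrib, Finset.prod_ite_zero]
    simp [Function.curry]
  rw [h1, h2, tensorVal]
  simp only [Finset.sum_mul_sum]
  rw [Fintype.sum_equiv ((Equiv.sumArrowEquivProdArrow _ _ (Fin n)).trans
    ((Equiv.refl _).prodCongr (Equiv.sumArrowEquivProdArrow _ _ (Fin n)))) _
    (fun q : (Fin k → Fin n) × ((Σ v, Fin (w v).1) → Fin n) × (S × Bool → Fin n) =>
      (∏ i, g (α i, q.1 i)) * t q.1 *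
        ((∏ p, g ((w p.1).2 p.2, q.2.1 p)) *
          (∏ v, h (∏ l : Fin (w v).1, MvPolynomial.X (q.2.1 ⟨v, l⟩))) *
          ((if ∀ s, q.2.2 (s, false) = q.2.2 (s, true) then 1 else 0) *
            ∏ p, g (b p.1 p.2, q.2.2 p)))) ?_]
  · simp only [Fintype.sum_prod_type, Finset.mul_sum]
  · intro col
    simp only [Fintype.prod_sum_type, Equiv.trans_apply, Equiv.sumArrowEquivProdArrow,
      Equiv.coe_fn_mk, Equiv.prodCongr_apply, Equiv.coe_refl, Prod.map, id, Function.comp_def,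
      Sum.elim_inl, Sum.elim_inr]
    split_ifs <;> ring

end

section

open MeasureTheory

variable {n k : ℕ}

theorem sum_mul_prod_arrow {Q α β : Type} [Fintype Q] [DecidableEq Q] [Fintype α] [Fintype β]
    (A : (Q → α) → ℝ) (B : (Q → β) → ℝ) :
    ∑ θ : Q → α × β, A (fun q => (θ q).1) * B (fun q => (θ q).2) = (∑ θ, A θ) * ∑ θ, B θ := by
  rw [Finset.sum_mul_sum, ← Fintype.sum_prod_type']
  exact Fintype.sum_equiv (Equiv.arrowProdEquivProdArrow Q (fun _ => α) (fun _ => β)) _ _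
    fun _ => rfl

theorem sum_mul_sum_pairing_eq_zero (h : VertexModel ℝ n) (t : Tensor ℝ n k)
    (ht : ∀ F, tpair t (ph h F) = 0) {X S Q : Type} [Fintype X] [Fintype S] [Fintype Q]
    [DecidableEq Q] [DecidableEq X] [DecidableEq S] (d : X → ℕ)
    (π : Fin k ⊕ (Σ v, Fin (d v)) ⊕ (S × Bool) ≃ Q × Bool)
    (row : Fin k ⊕ (Σ v, Fin (d v)) ⊕ (S × Bool) → Fin n) :
    ∑ col : Fin k ⊕ (Σ v, Fin (d v)) ⊕ (S × Bool) → Fin n,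
      (if ∀ s, col (.inr (.inr (s, false))) = col (.inr (.inr (s, true))) then
        t (fun j => col (.inl j)) * ∏ v, h (∏ l : Fin (d v),
          (MvPolynomial.X (col (.inr (.inl ⟨v, l⟩))) : MvPolynomial (Fin n) ℝ)) else 0) *
      ∑ θ : Q → Fin n × Fin n, (if ∀ p, (row p, col p) = θ (π p).1 then (1 : ℝ) else 0) = 0 := by
  have hπ : ∀ q, (Finset.univ.filter fun p => (π p).1 = q).card = 2 := by
    intro q
    rw [Finset.card_filter, Equiv.sum_comp π fun x => if x.1 = q then 1 else 0,
      Fintype.sum_prod_type]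
    simp only [Fintype.sum_bool, Finset.sum_add_distrib]
    simp
  obtain ⟨F, hF⟩ := exists_sum_pairing_eq_tpair h d (fun p => (π p).1) hπ
  simp only [Finset.mul_sum]
  rw [Finset.sum_comm]
  have hθ : ∀ θ : Q → Fin n × Fin n, ∑ col : Fin k ⊕ (Σ v, Fin (d v)) ⊕ (S × Bool) → Fin n,
      (if ∀ s, col (.inr (.inr (s, false))) = col (.inr (.inr (s, true))) then
        t (fun j => col (.inl j)) * ∏ v, h (∏ l : Fin (d v),
          (MvPolynomial.X (col (.inr (.inl ⟨v, l⟩))) : MvPolynomial (Fin n) ℝ)) else 0) *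
        (if ∀ p, (row p, col p) = θ (π p).1 then (1 : ℝ) else 0) =
      (if ∀ p, row p = (θ (π p).1).1 then 1 else 0) *
      (if ∀ s, (θ (π (.inr (.inr (s, false)))).1).2 = (θ (π (.inr (.inr (s, true)))).1).2 then
        t (fun j => (θ (π (.inl j)).1).2) * ∏ v, h (∏ l : Fin (d v),
          (MvPolynomial.X (θ (π (.inr (.inl ⟨v, l⟩))).1).2 : MvPolynomial (Fin n) ℝ)) else 0) := by
    intro θ
    rw [Finset.sum_eq_single fun p => (θ (π p).1).2]
    · rw [mul_comm]
      simp [Prod.ext_iff]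
    · intro col _ hcol
      rw [if_neg (c := ∀ p, (row p, col p) = θ (π p).1)
        fun H => hcol (funext fun p => congrArg Prod.snd (H p)), mul_zero]
    · simp
  simp only [hθ]
  exact (sum_mul_prod_arrow (fun θ : Q → Fin n => if ∀ p, row p = θ (π p).1 then (1 : ℝ) else 0)
    _).trans (mul_eq_zero_of_right _ ((hF t).trans (ht F)))

theorem integral_tensorVal_mul_prod_eq_zero (h : VertexModel ℝ n) (t : Tensor ℝ n k)
    (ht : ∀ F, tpair t (ph h F) = 0) (α : Fin k → Fin n) {X S : Type} [Fintype X] [Fintype S]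
    (w : X → Word n) (b : S → Bool → Fin n) (r : ℝ) :
    ∫ g in Metric.closedBall (0 : EuclideanSpace ℝ (Fin n × Fin n)) r,
      tensorVal t α g * ((∏ v, wordVal h (w v) g) * ∏ s, rowPair (b s) g) = 0 := by
  classical
  obtain ⟨c, hc⟩ := exists_setIntegral_ball_prod_eq
    (Fin k ⊕ (Σ v, Fin (w v).1) ⊕ (S × Bool)) (Fin n × Fin n) r
  simp only [tensorVal_mul_prod_eq_sum]
  rw [integral_finsetSum]
  · have hcol (col : Fin k ⊕ (Σ v, Fin (w v).1) ⊕ (S × Bool) → Fin n) :=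
      hc fun p => (Sum.elim α (Sum.elim (fun q : Σ v, Fin (w v).1 => (w q.1).2 q.2)
        (fun q : S × Bool => b q.1 q.2)) p, col p)
    simp only [integral_const_mul, hcol, mul_left_comm _ c]
    rw [← Finset.mul_sum]
    refine mul_eq_zero_of_right c ?_
    exact (Finset.sum_congr rfl fun col _ => Finset.mul_sum _ _ _).trans (Finset.sum_comm.trans
      (Finset.sum_eq_zero fun π _ => sum_mul_sum_pairing_eq_zero h t ht _ π _))
  · intro col _
    refine ContinuousOn.integrableOn_compact (isCompact_closedBall _ _) ?_
    fun_prop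

/-- The matrix of a point of Euclidean space. -/
def toMat (g : EuclideanSpace ℝ (Fin n × Fin n)) : Matrix (Fin n) (Fin n) ℝ :=
  Matrix.of fun i j => g (i, j)

theorem polSub_mul {𝔽 : Type} [Field 𝔽] (A B : Matrix (Fin n) (Fin n) 𝔽)
    (p : MvPolynomial (Fin n) 𝔽) : polSub (A * B) p = polSub B (polSub A p) := by
  simp only [polSub, AlgHom.toLinearMap_apply]
  rw [← AlgHom.comp_apply]
  congr 1
  ext1 i
  simp only [MvPolynomial.aeval_X, AlgHom.comp_apply, map_sum, map_mul, Matrix.mul_apply,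
    MvPolynomial.aeval_C, MvPolynomial.algebraMap_eq, Finset.sum_mul, Finset.mul_sum]
  rw [Finset.sum_comm]
  simp only [mul_assoc]

theorem polSub_one {𝔽 : Type} [Field 𝔽] (p : MvPolynomial (Fin n) 𝔽) :
    polSub (1 : Matrix (Fin n) (Fin n) 𝔽) p = p := by
  have : (MvPolynomial.aeval fun i : Fin n => ∑ j, MvPolynomial.C ((1 : Matrix (Fin n) (Fin n) 𝔽) i j)
      * MvPolynomial.X j) = AlgHom.id 𝔽 (MvPolynomial (Fin n) 𝔽) := by
    ext1 i
    simp [Matrix.one_apply, apply_ite]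
  simp [polSub, this]

theorem tact_mul {𝔽 : Type} [Field 𝔽] (A B : Matrix (Fin n) (Fin n) 𝔽) (t : Tensor 𝔽 n k) :
    tact (A * B) k t = tact A k (tact B k t) := by
  simp only [tact, Matrix.mulVecLin_apply, Matrix.mulVec_mulVec]
  congr 1
  ext φ ψ
  simp only [Matrix.of_apply, Matrix.mul_apply, Finset.prod_univ_sum, Fintype.piFinset_univ,
    Finset.prod_mul_distrib]

theorem exists_word_eq_monomial (d : Fin n →₀ ℕ) : ∃ w : Word n,
    MvPolynomial.monomial d (1 : ℝ) = ∏ l, MvPolynomial.X (w.2 l) := by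
  suffices ∃ L : List (Fin n), MvPolynomial.monomial d (1 : ℝ) = (L.map MvPolynomial.X).prod by
    obtain ⟨L, hL⟩ := this
    refine ⟨⟨L.length, L.get⟩, ?_⟩
    rw [hL]
    simp
  induction d using Finsupp.induction_linear with
  | zero => exact ⟨[], by simp⟩
  | add d d' h h' =>
    obtain ⟨L, hL⟩ := h
    obtain ⟨L', hL'⟩ := h'
    refine ⟨L ++ L', ?_⟩
    rw [List.map_append, List.prod_append, ← hL, ← hL', MvPolynomial.monomial_mul, one_mul]
  | single i m => exact ⟨List.replicate m i, by simp [MvPolynomial.X_pow_eq_monomial]⟩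

theorem wordVal_eq (h : VertexModel ℝ n) (w : Word n) (g : EuclideanSpace ℝ (Fin n × Fin n)) :
    wordVal h w g = h (polSub (toMat g) (∏ l, MvPolynomial.X (w.2 l))) := by
  simp only [polSub, AlgHom.toLinearMap_apply, map_prod, MvPolynomial.aeval_X, toMat,
    Matrix.of_apply]
  rw [Finset.prod_univ_sum, Fintype.piFinset_univ, map_sum]
  refine Finset.sum_congr rfl fun χ _ => ?_
  rw [Finset.prod_mul_distrib, ← map_prod MvPolynomial.C, MvPolynomial.C_mul', map_smul,
    smul_eq_mul]

theorem tensorVal_eq (t : Tensor ℝ n k) (α : Fin k → Fin n)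
    (g : EuclideanSpace ℝ (Fin n × Fin n)) : tensorVal t α g = tact (toMat g) k t α := rfl

/-- The orbit of a vertex model together with the Gram matrix of the rows separates the matrices
up to the stabilizer. -/
theorem tensorVal_mul_det_sq_eq (h : VertexModel ℝ n) {t : Tensor ℝ n k}
    (ht : t ∈ invSub (Stab h) k) (α : Fin k → Fin n) (x y : EuclideanSpace ℝ (Fin n × Fin n))
    (hw : ∀ w, wordVal h w x = wordVal h w y) (hb : ∀ b, rowPair b x = rowPair b y) :
    tensorVal t α x * (toMat x).det ^ 2 = tensorVal t α y * (toMat y).det ^ 2 := by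
  have hgram : toMat x * (toMat x).transpose = toMat y * (toMat y).transpose := by
    ext i j
    exact hb fun β => cond β j i
  have hdet : (toMat x).det ^ 2 = (toMat y).det ^ 2 := by
    have := congrArg Matrix.det hgram
    simpa [Matrix.det_mul, Matrix.det_transpose, ← sq] using this
  have hpol : ∀ p, h (polSub (toMat x) p) = h (polSub (toMat y) p) := by
    have : h ∘ₗ polSub (toMat x) = h ∘ₗ polSub (toMat y) := by
      refine (MvPolynomial.basisMonomials (Fin n) ℝ).ext fun d => ?_
      obtain ⟨w, hw'⟩ := exists_word_eq_monomial d
      simp only [MvPolynomial.coe_basisMonomials, LinearMap.comp_apply, hw', ← wordVal_eq, hw]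
    exact LinearMap.congr_fun this
  rw [hdet]
  by_cases h0 : (toMat x).det = 0
  · rw [← hdet, h0]
    simp
  congr 1
  have hu : IsUnit (toMat x).det := isUnit_iff_ne_zero.2 h0
  set u := (toMat x)⁻¹ * toMat y with hu_def
  have hy : toMat y = toMat x * u := by
    rw [hu_def, Matrix.mul_nonsing_inv_cancel_left _ _ hu]
  have huo : u * u.transpose = 1 := by
    rw [hu_def, Matrix.transpose_mul, Matrix.mul_assoc, ← Matrix.mul_assoc (toMat y), ← hgram,
      Matrix.mul_assoc, ← Matrix.mul_assoc, Matrix.nonsing_inv_mul _ hu, Matrix.one_mul,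
      ← Matrix.transpose_mul, Matrix.nonsing_inv_mul _ hu, Matrix.transpose_one]
  have hstab : u ∈ Stab h := by
    refine ⟨mul_eq_one_comm.1 huo, LinearMap.ext fun p => ?_⟩
    have hp : p = polSub (toMat x) (polSub (toMat x)⁻¹ p) := by
      rw [← polSub_mul, Matrix.nonsing_inv_mul _ hu, polSub_one]
    change h (polSub u p) = h p
    rw [hp, ← polSub_mul, ← hy, hpol]
  rw [tensorVal_eq, tensorVal_eq, hy, tact_mul, ht u hstab]

/-- The values of the transformed vertex model and the Gram matrix entries, as continuous
functions of the matrix. -/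
noncomputable def generators (h : VertexModel ℝ n) : Set C(EuclideanSpace ℝ (Fin n × Fin n), ℝ) :=
  Set.range (fun w => ⟨wordVal h w, by unfold wordVal; fun_prop⟩) ∪
    Set.range (fun b => ⟨rowPair b, by unfold rowPair; fun_prop⟩)

theorem exists_prod_eq_of_mem_closure (h : VertexModel ℝ n)
    {p : C(EuclideanSpace ℝ (Fin n × Fin n), ℝ)} (hp : p ∈ Submonoid.closure (generators h)) :
    ∃ (X S : Type) (_ : Fintype X) (_ : Fintype S) (w : X → Word n) (b : S → Bool → Fin n),
      ∀ g, p g = (∏ v, wordVal h (w v) g) * ∏ s, rowPair (b s) g := by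
  induction hp using Submonoid.closure_induction with
  | mem p hp =>
    rcases hp with ⟨w, rfl⟩ | ⟨b, rfl⟩
    · exact ⟨Unit, Empty, inferInstance, inferInstance, fun _ => w, Empty.elim, fun g => by simp⟩
    · exact ⟨Empty, Unit, inferInstance, inferInstance, Empty.rec, fun _ => b, fun g => by simp⟩
  | one => exact ⟨Empty, Empty, inferInstance, inferInstance, Empty.rec, Empty.elim, by simp⟩
  | mul p q _ _ hp hq =>
    obtain ⟨X, S, _, _, w, b, hp⟩ := hp
    obtain ⟨X', S', _, _, w', b', hq⟩ := hq
    refine ⟨X ⊕ X', S ⊕ S', inferInstance, inferInstance, Sum.elim w w', Sum.elim b b',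
      fun g => ?_⟩
    simp only [ContinuousMap.mul_apply, hp, hq, Fintype.prod_sum_type, Sum.elim_inl, Sum.elim_inr]
    ring

theorem integral_tensorVal_mul_eq_zero_of_mem_adjoin (h : VertexModel ℝ n) (t : Tensor ℝ n k)
    (ht : ∀ F, tpair t (ph h F) = 0) (α : Fin k → Fin n) (r : ℝ)
    {p : C(EuclideanSpace ℝ (Fin n × Fin n), ℝ)} (hp : p ∈ Algebra.adjoin ℝ (generators h)) :
    ∫ g in Metric.closedBall (0 : EuclideanSpace ℝ (Fin n × Fin n)) r,
      tensorVal t α g * p g = 0 := by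
  have hInt : ∀ q : C(EuclideanSpace ℝ (Fin n × Fin n), ℝ),
      IntegrableOn (fun g => tensorVal t α g * q g) (Metric.closedBall 0 r) := fun q =>
    (Continuous.continuousOn (by unfold tensorVal; fun_prop)).integrableOn_compact
      (isCompact_closedBall _ _)
  rw [← Subalgebra.mem_toSubmodule, Algebra.adjoin_eq_span] at hp
  induction hp using Submodule.span_induction with
  | mem p hp =>
    obtain ⟨X, S, _, _, w, b, hp⟩ := exists_prod_eq_of_mem_closure h hp
    simp only [hp]
    exact integral_tensorVal_mul_prod_eq_zero h t ht α w b r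
  | zero => simp
  | add p q _ _ hp hq =>
    simp only [ContinuousMap.add_apply, mul_add]
    rw [integral_add (hInt p) (hInt q), hp, hq, add_zero]
  | smul c p _ hp =>
    simp only [ContinuousMap.smul_apply, smul_eq_mul, mul_left_comm _ c]
    rw [integral_const_mul, hp, mul_zero]

theorem eq_zero_of_mem_invSub_of_forall_tpair_ph (h : VertexModel ℝ n) {t : Tensor ℝ n k}
    (ht : t ∈ invSub (Stab h) k) (h0 : ∀ F, tpair t (ph h F) = 0) : t = 0 := by
  funext α
  let y : EuclideanSpace ℝ (Fin n × Fin n) :=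
    WithLp.toLp 2 fun p => (1 : Matrix (Fin n) (Fin n) ℝ) p.1 p.2
  have hy : toMat y = 1 := rfl
  have hcF : Continuous (tensorVal t α) := by unfold tensorVal; fun_prop
  have hcM : Continuous (toMat (n := n)) := by
    refine continuous_matrix fun i j => ?_
    simp only [toMat, Matrix.of_apply]
    fun_prop
  have hcD : Continuous fun g : EuclideanSpace ℝ (Fin n × Fin n) => (toMat g).det := hcM.matrix_det
  have hInt := setIntegral_mul_eq_zero_of_adjoin (μ := volume)
    (isCompact_closedBall (0 : EuclideanSpace ℝ (Fin n × Fin n)) (‖y‖ + 1)) (generators h)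
    ⟨tensorVal t α, hcF⟩ ⟨fun g => tensorVal t α g * (toMat g).det ^ 2, by fun_prop⟩
    (fun x x' hx => tensorVal_mul_det_sq_eq h ht α x x' (fun w => hx _ (Or.inl ⟨w, rfl⟩))
      fun b => hx _ (Or.inr ⟨b, rfl⟩))
    (fun p hp => integral_tensorVal_mul_eq_zero_of_mem_adjoin h t h0 α _ hp)
  simp only [ContinuousMap.coe_mk] at hInt
  have hsq : ∀ g, tensorVal t α g * (tensorVal t α g * (toMat g).det ^ 2) =
      (tensorVal t α g * (toMat g).det) ^ 2 := fun g => by ring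
  simp only [hsq] at hInt
  have hc : Continuous fun g => (tensorVal t α g * (toMat g).det) ^ 2 := by fun_prop
  rw [setIntegral_eq_zero_iff_of_nonneg_ae (Filter.Eventually.of_forall fun g => sq_nonneg _)
    (hc.continuousOn.integrableOn_compact (isCompact_closedBall _ _))] at hInt
  have hae := ae_mono (Measure.restrict_mono Metric.ball_subset_closedBall le_rfl) hInt
  have heq := Measure.eqOn_open_of_ae_eq hae Metric.isOpen_ball hc.continuousOn continuousOn_const
  have hval : (tensorVal t α y * (toMat y).det) ^ 2 = 0 :=
    heq (show y ∈ Metric.ball 0 (‖y‖ + 1) by simp)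
  have hone : tact 1 k t = t :=
    ht 1 ⟨by simp [orthSet], LinearMap.ext fun p => congrArg h (polSub_one p)⟩
  rw [tensorVal_eq, hy, Matrix.det_one, mul_one, hone] at hval
  exact pow_eq_zero_iff two_ne_zero |>.1 hval

end

end VertexModels

/-- **Theorem 2** (the real case).  For a real vertex model `h`, the rank of
the edge connection matrix `M_{f_h,k}` equals `dim (V^{⊗k})^{Stab(h)}`. -/
theorem real_rank_edge_connection_matrix (n : ℕ) (h : VertexModel ℝ n) (k : ℕ) :
    connectionRank h k = Module.finrank ℝ (invSub (Stab h) k) := by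
  rw [connectionRank_eq_finrank_span]
  refine finrank_eq_of_forall_tpair_eq_zero (span_range_ph_le_invSub h k) fun t ht h0 => ?_
  exact eq_zero_of_mem_invSub_of_forall_tpair_ph h ht fun F =>
    h0 _ (Submodule.subset_span ⟨F, rfl⟩)
end

section
/- For every vertex model h ∈ R*, every k ∈ ℕ, all 1 ≤ i < j ≤ k, and every k-fragment F, one has p_h(Γ^k_{i,j}(F)) = C^k_{i,j}(p_h(F)); that is, the map p_h intertwines the fragment contraction Γ^k_{i,j} with the tensor contraction C^k_{i,j}. -/
/-!
Formalization framework for "Partition functions of vertex models /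
edge connection matrices" (Regts–Draisma style).

Graphs and fragments are finite multigraphs (allowing multiple edges, loops
and circles); a `k`-fragment additionally has `k` labelled open ends.  We
encode a `k`-fragment by a number `nv` of internal vertices, a number `ne`
of edges, and for each edge the multiset of its endpoints, each endpoint
being either an internal vertex (`Sum.inl`) or an open-end label
(`Sum.inr`).  Every edge has `2` endpoints (counted with multiplicity; a
loop at `v` lists `v` twice) or `0` endpoints (a circle), and every label
occurs exactly once in total (the open ends have degree one).
-/

open MvPolynomial

open VertexModels

namespace VertexModels

section Labels

variable {m nv : ℕ} (i j : Fin (m + 2))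

/-- The label `j` among the labels remaining after `i` has been removed (`i < j`). -/
def predLabel : Fin (m + 1) := ⟨j.1 - 1, by have := j.isLt; omega⟩

/-- The order-preserving enumeration of the labels other than `i` and `j` (`i < j`). -/
def upLabel (l : Fin m) : Fin (m + 2) := i.succAbove ((predLabel j).succAbove l)

variable {i j}

lemma succAbove_predLabel (hij : i < j) : i.succAbove (predLabel j) = j := by
  have := Fin.lt_def.1 hij
  ext
  simp only [Fin.succAbove, predLabel, Fin.lt_def, Fin.val_castSucc]
  split_ifs <;> simp <;> omega

lemma upLabel_ne_left (l : Fin m) : upLabel i j l ≠ i := Fin.succAbove_ne _ _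

lemma upLabel_ne_right (hij : i < j) (l : Fin m) : upLabel i j l ≠ j := fun h =>
  Fin.succAbove_ne _ _ (Fin.succAbove_right_injective (h.trans (succAbove_predLabel hij).symm))

lemma eq_or_eq_or_exists_upLabel (hij : i < j) (l : Fin (m + 2)) :
    l = i ∨ l = j ∨ ∃ x, l = upLabel i j x := by
  rcases Fin.eq_self_or_eq_succAbove i l with h | ⟨l', rfl⟩
  · exact .inl h
  rcases Fin.eq_self_or_eq_succAbove (predLabel j) l' with rfl | ⟨x, rfl⟩
  · exact .inr (.inl (succAbove_predLabel hij))
  · exact .inr (.inr ⟨x, rfl⟩)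

lemma downLabel_upLabel (hij : i < j) (l : Fin m) (h) :
    downLabel i j (upLabel i j l) hij h = l := by
  have := Fin.lt_def.1 hij
  ext
  simp only [downLabel, upLabel, Fin.succAbove, predLabel, Fin.lt_def, Fin.val_castSucc]
  split_ifs <;> simp_all <;> omega

lemma removeEnd_eq_some_iff (hij : i < j) (x : Fin nv ⊕ Fin (m + 2)) (y : Fin nv ⊕ Fin m) :
    removeEnd i j hij x = some y ↔ x = Sum.map id (upLabel i j) y := by
  rcases x with v | l
  · rcases y with w | l' <;> simp [removeEnd]
  · rcases eq_or_eq_or_exists_upLabel hij l with rfl | rfl | ⟨l, rfl⟩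
    · rcases y with w | l' <;> simp [removeEnd, (upLabel_ne_left _).symm]
    · rcases y with w | l' <;> simp [removeEnd, (upLabel_ne_right hij _).symm]
    · have h : ¬ (upLabel i j l = i ∨ upLabel i j l = j) :=
        not_or.2 ⟨upLabel_ne_left l, upLabel_ne_right hij l⟩
      have inj : Function.Injective (upLabel i j) :=
        Fin.succAbove_right_injective.comp Fin.succAbove_right_injective
      rcases y with w | l' <;> simp [removeEnd, h, downLabel_upLabel, inj.eq_iff]

lemma count_filterMap_removeEnd (hij : i < j) (s : Multiset (Fin nv ⊕ Fin (m + 2)))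
    (y : Fin nv ⊕ Fin m) :
    (s.filterMap (removeEnd i j hij)).count y = s.count (Sum.map id (upLabel i j) y) := by
  induction s using Multiset.induction with
  | empty => simp
  | cons a s ih =>
    have key := removeEnd_eq_some_iff hij a y
    rcases hr : removeEnd i j hij a with _ | b
    · rw [hr] at key
      rw [Multiset.filterMap_cons_none _ _ hr, ih, Multiset.count_cons_of_ne]
      exact fun h => by simpa using key.2 h.symm
    · rw [hr, Option.some_inj] at key
      rw [Multiset.filterMap_cons_some _ _ _ hr, Multiset.count_cons, Multiset.count_cons, ih]
      simp only [eq_comm (a := y), eq_comm (b := a), key]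

lemma card_filterMap_removeEnd (hij : i < j) (s : Multiset (Fin nv ⊕ Fin (m + 2))) :
    (s.filterMap (removeEnd i j hij)).card + s.count (.inr i) + s.count (.inr j) = s.card := by
  induction s using Multiset.induction with
  | empty => simp
  | cons a s ih =>
    rcases a with v | l
    · rw [Multiset.filterMap_cons_some (removeEnd i j hij) _ _ (b := Sum.inl v) rfl]
      simp; omega
    · by_cases h : l = i ∨ l = j
      · rw [Multiset.filterMap_cons_none _ _ (by simp [removeEnd, h])]
        rcases h with rfl | rfl
        · simp [hij.ne']; omega
        · simp [hij.ne]; omega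
      · rw [Multiset.filterMap_cons_some (removeEnd i j hij) _ _
          (b := Sum.inr (downLabel i j l hij h)) (by simp [removeEnd, h])]
        obtain ⟨h₁, h₂⟩ := not_or.1 h
        simp [Ne.symm h₁, Ne.symm h₂]; omega

end Labels

lemma Fragment.exists_count_eq {k : ℕ} (F : Fragment k) (l : Fin k) :
    ∃ e, ∀ e', (F.inc e').count (.inr l) = if e' = e then 1 else 0 := by
  have hsum := F.openEnd l
  obtain ⟨e, -, he⟩ := Finset.exists_ne_zero_of_sum_ne_zero (hsum.trans_ne one_ne_zero)
  rw [← Finset.add_sum_erase _ _ (Finset.mem_univ e)] at hsum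
  refine ⟨e, fun e' => ?_⟩
  split_ifs with h
  · subst h; omega
  · have hrest : ∑ x ∈ Finset.univ.erase e, (F.inc x).count (.inr l) = 0 := by omega
    exact Finset.sum_eq_zero_iff.1 hrest e' (by simp [h])

lemma Fragment.mem_inc_iff {k : ℕ} {F : Fragment k} {l : Fin k} {e : Fin F.ne}
    (he : ∀ e', (F.inc e').count (.inr l) = if e' = e then 1 else 0) (e' : Fin F.ne) :
    Sum.inr l ∈ F.inc e' ↔ e' = e := by
  rw [← Multiset.count_pos, he]
  split_ifs <;> simp [*]

section Contract

variable {m : ℕ} (F : Fragment (m + 2)) (i j : Fin (m + 2))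

/-- The edge of the contracted fragment into which the edge `e` is merged. -/
noncomputable def contractMk (e : Fin F.ne) : Fin (contractNE F i j) :=
  (contractEquiv F i j).symm (Quotient.mk _ e)

variable {F i j}

lemma contractMk_surjective : Function.Surjective (contractMk F i j) :=
  (contractEquiv F i j).symm.surjective.comp Quotient.mk_surjective

lemma contractMk_eq_iff {e e' : Fin F.ne} :
    contractMk F i j e = contractMk F i j e' ↔ e = e' ∨
      (Sum.inr i ∈ F.inc e ∨ Sum.inr j ∈ F.inc e) ∧
      (Sum.inr i ∈ F.inc e' ∨ Sum.inr j ∈ F.inc e') := by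
  rw [contractMk, contractMk, (contractEquiv F i j).symm.injective.eq_iff, Quotient.eq]
  constructor
  · intro h
    induction h with
    | rel _ _ h => exact .inr h
    | refl => exact .inl rfl
    | symm _ _ _ ih => exact ih.imp Eq.symm And.symm
    | trans x y z _ _ ih₁ ih₂ =>
      rcases ih₁ with rfl | h₁
      · exact ih₂
      · rcases ih₂ with rfl | h₂
        · exact .inr h₁
        · exact .inr ⟨h₁.1, h₂.2⟩
  · rintro (rfl | h)
    · exact .refl _
    · exact .rel _ _ h

open Classical in
lemma contractInc_eq (hij : i < j) (c : Fin (contractNE F i j)) :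
    contractInc F i j hij c = ∑ e with contractMk F i j e = c,
      (F.inc e).filterMap (removeEnd i j hij) := by
  unfold contractInc contractMk
  simp only [Equiv.symm_apply_eq]

open Classical in
lemma count_contractInc (hij : i < j) (c : Fin (contractNE F i j)) (y : Fin F.nv ⊕ Fin m) :
    (contractInc F i j hij c).count y = ∑ e with contractMk F i j e = c,
      (F.inc e).count (Sum.map id (upLabel i j) y) := by
  simp only [contractInc_eq, Multiset.count_sum', count_filterMap_removeEnd]

lemma inr_mem_contractInc (hij : i < j) {c : Fin (contractNE F i j)} {l : Fin m} :
    Sum.inr l ∈ contractInc F i j hij c ↔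
      ∃ e, contractMk F i j e = c ∧ Sum.inr (upLabel i j l) ∈ F.inc e := by
  classical
  simp [contractInc_eq, Multiset.mem_sum, removeEnd_eq_some_iff]

lemma sum_count_contractInc (hij : i < j) (l : Fin m) :
    ∑ c, (contractInc F i j hij c).count (.inr l) = 1 := by
  classical
  simp only [count_contractInc, Sum.map_inr]
  rw [Finset.sum_fiberwise, F.openEnd]

lemma card_contractInc (hij : i < j) (c : Fin (contractNE F i j)) :
    (contractInc F i j hij c).card = 2 ∨ (contractInc F i j hij c).card = 0 := by
  classical
  obtain ⟨e, rfl⟩ := contractMk_surjective c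
  obtain ⟨a, ha⟩ := F.exists_count_eq i
  obtain ⟨b, hb⟩ := F.exists_count_eq j
  have mem_i := Fragment.mem_inc_iff ha
  have mem_j := Fragment.mem_inc_iff hb
  have hcard := fun e => card_filterMap_removeEnd hij (F.inc e)
  simp only [ha, hb] at hcard
  rw [contractInc_eq, Multiset.card_sum]
  simp only [contractMk_eq_iff, mem_i, mem_j]
  by_cases he : e = a ∨ e = b
  · have hfilter : (Finset.univ.filter fun x => x = e ∨ (x = a ∨ x = b) ∧ (e = a ∨ e = b)) =
        {a, b} := by
      ext x
      simp only [he, and_true, Finset.mem_filter, Finset.mem_univ, true_and,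
        Finset.mem_insert, Finset.mem_singleton]
      grind
    rw [hfilter]
    have h₁ := hcard a
    have h₂ := hcard b
    have h₃ := F.card_inc a
    have h₄ := F.card_inc b
    by_cases hab : a = b
    · subst hab
      simp only [if_true] at h₁
      rw [Finset.pair_eq_singleton, Finset.sum_singleton]
      omega
    · rw [Finset.sum_pair hab]
      simp [hab, Ne.symm hab] at h₁ h₂; omega
  · have h₁ := hcard e
    have h₂ := F.card_inc e
    obtain ⟨hea, heb⟩ := not_or.1 he
    simp only [he, and_false, or_false, Finset.filter_eq', Finset.mem_univ, if_true,
      Finset.sum_singleton]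
    simp [hea, heb] at h₁; omega

lemma fragContract_eq (hij : i < j) :
    fragContract i j hij F =
      { nv := F.nv
        ne := contractNE F i j
        inc := contractInc F i j hij
        card_inc := card_contractInc hij
        openEnd := sum_count_contractInc hij } :=
  dif_pos ⟨card_contractInc hij, sum_count_contractInc hij⟩

end Contract

end VertexModels


open VertexModels

/-- **Lemma 10**: `p_h` intertwines the contraction of fragments with the
contraction of tensors: `p_h(Γ^k_{i,j}(F)) = C^k_{i,j}(p_h(F))`. -/
theorem ph_fragContract (𝔽 : Type) [Field 𝔽] (n m : ℕ) (h : VertexModel 𝔽 n)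
    (i j : Fin (m + 2)) (hij : i < j) (F : Fragment (m + 2)) :
    ph h (fragContract i j hij F) = tcontract i j (ph h F) := by
  classical
  rw [fragContract_eq]
  funext φ
  obtain ⟨a, ha⟩ := F.exists_count_eq i
  obtain ⟨b, hb⟩ := F.exists_count_eq j
  have mem_i := Fragment.mem_inc_iff ha
  have mem_j := Fragment.mem_inc_iff hb
  let η (c : Fin n) : Fin (m + 2) → Fin n := i.insertNth c ((predLabel j).insertNth c φ)
  have hη_i (c) : η c i = c := by simp [η]
  have hη_j (c) : η c j = c := by
    conv_lhs => rw [← succAbove_predLabel hij]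
    simp [η]
  have hη_up (c x) : η c (upLabel i j x) = φ x := by simp [η, upLabel]
  change hphi h _ φ = ∑ c, hphi h F (η c)
  unfold hphi
  rw [Finset.sum_sigma']
  have lift_apply {c : Fin n} {ψ : Fin F.ne → Fin n}
      (hψ : ∀ e l, Sum.inr l ∈ F.inc e → ψ e = η c l) (e : Fin F.ne) :
      ψ (Function.surjInv contractMk_surjective (contractMk F i j e)) = ψ e := by
    have hend : ∀ e, Sum.inr i ∈ F.inc e ∨ Sum.inr j ∈ F.inc e → ψ e = c := by
      rintro e (he | he)
      · rw [hψ e i he, hη_i]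
      · rw [hψ e j he, hη_j]
    rcases contractMk_eq_iff.1
      (Function.surjInv_eq contractMk_surjective (contractMk F i j e)) with h | ⟨h₁, h₂⟩
    · rw [h]
    · rw [hend _ h₁, hend _ h₂]
  refine Finset.sum_bij' (fun ψ _ => ⟨ψ (contractMk F i j a), ψ ∘ contractMk F i j⟩)
    (fun p _ => p.2 ∘ Function.surjInv contractMk_surjective) ?_ ?_ ?_ ?_ ?_
  · intro ψ hψ
    simp only [Finset.mem_filter, Finset.mem_univ, true_and, Finset.mem_sigma] at hψ ⊢
    intro e l hl
    rcases eq_or_eq_or_exists_upLabel hij l with rfl | rfl | ⟨l, rfl⟩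
    · rw [hη_i, (mem_i e).1 hl]; rfl
    · rw [hη_j]
      exact congrArg ψ (contractMk_eq_iff.2 (.inr ⟨.inr hl, .inl ((mem_i a).2 rfl)⟩))
    · rw [hη_up]
      exact hψ _ _ ((inr_mem_contractInc hij).2 ⟨e, rfl, hl⟩)
  · rintro ⟨c, ψ⟩ hψ
    simp only [Finset.mem_filter, Finset.mem_univ, true_and, Finset.mem_sigma] at hψ ⊢
    intro q l hl
    obtain ⟨e, rfl, he⟩ := (inr_mem_contractInc hij).1 hl
    rw [Function.comp_apply, lift_apply hψ, hψ _ _ he, hη_up]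
  · intro ψ _
    funext q
    exact congrArg ψ (Function.surjInv_eq contractMk_surjective q)
  · rintro ⟨c, ψ⟩ hψ
    simp only [Finset.mem_filter, Finset.mem_univ, true_and, Finset.mem_sigma] at hψ
    have hψ' : (ψ ∘ Function.surjInv contractMk_surjective) ∘ contractMk F i j = ψ :=
      funext (lift_apply hψ)
    have hc : (ψ ∘ Function.surjInv contractMk_surjective) (contractMk F i j a) = c := by
      rw [Function.comp_apply, lift_apply hψ, hψ a i ((mem_i a).2 rfl), hη_i]
    rw [hψ', hc]
  · intro ψ _
    refine Finset.prod_congr rfl fun v _ => congrArg h ?_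
    simp only [monomialAt, count_contractInc, Function.comp_apply, Sum.map_inl, id]
    rw [← Finset.prod_fiberwise Finset.univ (contractMk F i j)]
    refine Finset.prod_congr rfl fun q _ => ?_
    rw [← Finset.prod_pow_eq_pow_sum]
    refine Finset.prod_congr rfl fun e he => ?_
    rw [(Finset.mem_filter.1 he).2]
end

section
/- For every vertex model h ∈ R*, the stabilizer Stab(h) equals the pointwise stabilizer Stab(p_h(𝒜)) = ∩_{a ∈ p_h(𝒜)} {g ∈ O_n : ga = a} of the image of p_h in the tensor algebra. -/
/-!
Formalization framework for "Partition functions of vertex models /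
edge connection matrices" (Regts–Draisma style).

Graphs and fragments are finite multigraphs (allowing multiple edges, loops
and circles); a `k`-fragment additionally has `k` labelled open ends.  We
encode a `k`-fragment by a number `nv` of internal vertices, a number `ne`
of edges, and for each edge the multiset of its endpoints, each endpoint
being either an internal vertex (`Sum.inl`) or an open-end label
(`Sum.inr`).  Every edge has `2` endpoints (counted with multiplicity; a
loop at `v` lists `v` twice) or `0` endpoints (a circle), and every label
occurs exactly once in total (the open ends have degree one).
-/

open MvPolynomial

open VertexModels

namespace VertexModels

variable {𝔽 : Type} [Field 𝔽] {n : ℕ}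

theorem dualAct_prod_X (g : Matrix (Fin n) (Fin n) 𝔽) (h : VertexModel 𝔽 n)
    {ι : Type} [Fintype ι] [DecidableEq ι] (f : ι → Fin n) :
    dualAct g h (∏ d, X (f d)) =
      ∑ χ : ι → Fin n, (∏ d, g (f d) (χ d)) * h (∏ d, X (χ d)) := by
  have key : polSub g (∏ d, X (f d)) =
      ∑ χ : ι → Fin n, (∏ d, g (f d) (χ d)) • ∏ d, (X (χ d) : MvPolynomial (Fin n) 𝔽) := by
    simp only [polSub, AlgHom.toLinearMap_apply, map_prod, aeval_X]
    rw [Fintype.prod_sum]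
    refine Finset.sum_congr rfl fun χ _ => ?_
    rw [Finset.prod_mul_distrib, ← map_prod, MvPolynomial.smul_eq_C_mul]
  simp only [dualAct, LinearMap.comp_apply, key, map_sum, map_smul, smul_eq_mul]

theorem polSub_polSub_transpose {g : Matrix (Fin n) (Fin n) 𝔽} (hg : g ∈ orthSet 𝔽 n)
    (p : MvPolynomial (Fin n) 𝔽) : polSub g (polSub g.transpose p) = p := by
  have key : (aeval (fun i => ∑ j, C (g i j) * X j) :
        MvPolynomial (Fin n) 𝔽 →ₐ[𝔽] MvPolynomial (Fin n) 𝔽).comp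
      (aeval (fun i => ∑ j, C (g.transpose i j) * X j)) = AlgHom.id 𝔽 _ := by
    ext1 i
    have hg' : ∀ l, ∑ j, g j i * g j l = if i = l then 1 else 0 := fun l => by
      have := congrFun (congrFun hg i) l
      simpa [Matrix.mul_apply, Matrix.one_apply] using this
    simp only [AlgHom.comp_apply, aeval_X, map_sum, map_mul, algHom_C, algebraMap_eq,
      Matrix.transpose_apply, AlgHom.id_apply, Finset.mul_sum]
    rw [Finset.sum_comm]
    simp only [← mul_assoc, ← map_mul, ← Finset.sum_mul, ← map_sum, hg']
    simp
  exact DFunLike.congr_fun key p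

theorem dualAct_transpose_eq {g : Matrix (Fin n) (Fin n) 𝔽} {h : VertexModel 𝔽 n}
    (hg : g ∈ Stab h) : dualAct g.transpose h = h := by
  obtain ⟨ho, hs⟩ := hg
  refine LinearMap.ext fun p => ?_
  conv_lhs => rw [← hs]
  exact congrArg h (polSub_polSub_transpose ho _)

theorem vertexModel_ext {h h' : VertexModel 𝔽 n}
    (H : ∀ (k : ℕ) (φ : Fin k → Fin n), h (∏ i, X (φ i)) = h' (∏ i, X (φ i))) : h = h' := by
  refine (basisMonomials (Fin n) 𝔽).ext fun s => ?_
  have hs : (basisMonomials (Fin n) 𝔽 s : MvPolynomial (Fin n) 𝔽) =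
      (s.toMultiset.map X).prod := by
    simp only [coe_basisMonomials]
    rw [monomial_eq, Finsupp.toMultiset_map, Finsupp.prod_toMultiset,
      Finsupp.prod_mapDomain_index pow_zero pow_add, C_1, one_mul]
  rw [hs]
  induction s.toMultiset using Quot.inductionOn with
  | _ l =>
    have := H l.length l.get
    rw [← List.prod_ofFn] at this
    simpa [List.ofFn_getElem_eq_map] using this

theorem inr_mem_basicFragment_inc {k : ℕ} (e j : Fin k) :
    Sum.inr j ∈ (basicFragment k).inc e ↔ j = e := by
  change (Sum.inr j : Fin 1 ⊕ Fin k) ∈ ({Sum.inl 0, Sum.inr e} : Multiset (Fin 1 ⊕ Fin k)) ↔ _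
  simp

theorem count_inl_basicFragment_inc {k : ℕ} (e : Fin k) :
    ((basicFragment k).inc e).count (Sum.inl (0 : Fin 1)) = 1 := by
  change ({Sum.inl 0, Sum.inr e} : Multiset (Fin 1 ⊕ Fin k)).count (Sum.inl 0) = 1
  simp

theorem hphi_basicFragment (h : VertexModel 𝔽 n) {k : ℕ} (φ : Fin k → Fin n) :
    hphi h (basicFragment k) φ = h (∏ i, X (φ i)) := by
  obtain ⟨φ', hφ'⟩ : ∃ φ' : Fin (basicFragment k).ne → Fin n, ∀ i : Fin k, φ' i = φ i :=
    ⟨φ, fun _ => rfl⟩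
  have hf : (Finset.univ.filter fun ψ : Fin (basicFragment k).ne → Fin n =>
      ∀ (e : Fin (basicFragment k).ne) (j : Fin k),
        Sum.inr j ∈ (basicFragment k).inc e → ψ e = φ j) = {φ'} := by
    ext ψ
    simp only [Finset.mem_filter, Finset.mem_univ, true_and, Finset.mem_singleton]
    constructor
    · intro H
      funext e
      exact (H e e ((inr_mem_basicFragment_inc _ _).mpr rfl)).trans (hφ' e).symm
    · rintro rfl e j hj
      obtain rfl := (inr_mem_basicFragment_inc _ _).mp hj
      exact hφ' _
  rw [hphi, hf, Finset.sum_singleton]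
  change ∏ v : Fin 1, _ = _
  rw [Fin.prod_univ_one]
  refine congrArg h (Finset.prod_congr rfl fun e _ => ?_)
  exact (congrArg₂ (fun i m => X i ^ m) (hφ' e) (count_inl_basicFragment_inc e)).trans (pow_one _)

theorem tact_apply (g : Matrix (Fin n) (Fin n) 𝔽) (k : ℕ) (t : Tensor 𝔽 n k)
    (φ : Fin k → Fin n) : tact g k t φ = ∑ ψ, (∏ i, g (φ i) (ψ i)) * t ψ := rfl

theorem tact_one (k : ℕ) (t : Tensor 𝔽 n k) : tact 1 k t = t := by
  have : (Matrix.of fun φ ψ : Fin k → Fin n => ∏ i, (1 : Matrix (Fin n) (Fin n) 𝔽) (φ i) (ψ i))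
      = 1 := by
    ext φ ψ
    simp only [Matrix.of_apply, Matrix.one_apply, Finset.prod_ite_zero, Finset.prod_const_one,
      funext_iff, Finset.mem_univ, true_implies]
  rw [tact, this, Matrix.mulVecLin_one, LinearMap.id_apply]

/-- The half edges of `F` at the internal vertex `v`. -/
abbrev HalfEdges {k : ℕ} (F : Fragment k) (v : Fin F.nv) : Type :=
  Σ e : Fin F.ne, Fin ((F.inc e).count (Sum.inl v))

theorem monomialAt_eq_prod {k : ℕ} (F : Fragment k) (ψ : Fin F.ne → Fin n) (v : Fin F.nv) :
    (monomialAt F ψ v : MvPolynomial (Fin n) 𝔽) = ∏ d : HalfEdges F v, X (ψ d.1) := by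
  simp [monomialAt, Fintype.prod_sigma]

/-- The unique edge incident with the open end `j`. -/
theorem exists_openEnd_edge {k : ℕ} (F : Fragment k) (j : Fin k) :
    ∃ e, ∀ e', (F.inc e').count (Sum.inr j) = if e' = e then 1 else 0 := by
  obtain ⟨e, he⟩ : ∃ e, (F.inc e).count (Sum.inr j) ≠ 0 := by
    by_contra! H
    simpa [H] using F.openEnd j
  have hsum := F.openEnd j
  rw [← Finset.add_sum_erase _ _ (Finset.mem_univ e)] at hsum
  refine ⟨e, fun e' => ?_⟩
  split_ifs with h
  · subst h; omega
  · have h0 : ∑ x ∈ Finset.univ.erase e, (F.inc x).count (Sum.inr j) = 0 := by omega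
    exact Finset.sum_eq_zero_iff.mp h0 e' (by simp [h])

theorem tact_ph_eq_sum_edge (g : Matrix (Fin n) (Fin n) 𝔽) (h : VertexModel 𝔽 n) {k : ℕ}
    (F : Fragment k) (φ : Fin k → Fin n) :
    tact g k (ph h F) φ = ∑ ψ : Fin F.ne → Fin n,
      (∏ e, ∏ j, g (φ j) (ψ e) ^ (F.inc e).count (Sum.inr j)) *
        ∏ v, h (monomialAt F ψ v) := by
  choose ε hε using exists_openEnd_edge F
  have hmem : ∀ e j, Sum.inr j ∈ F.inc e ↔ e = ε j := fun e j => by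
    rw [← Multiset.count_pos, hε]
    split_ifs <;> simp_all
  have hfilter : ∀ (ψ : Fin F.ne → Fin n) (φ' : Fin k → Fin n),
      (∀ e j, Sum.inr j ∈ F.inc e → ψ e = φ' j) ↔ φ' = fun j => ψ (ε j) := by
    intro ψ φ'
    simp only [hmem, funext_iff]
    constructor
    · intro H j
      exact (H _ _ rfl).symm
    · rintro H e j rfl
      exact (H j).symm
  simp only [tact_apply, ph, hphi, Finset.sum_filter, Finset.mul_sum]
  rw [Finset.sum_comm]
  refine Finset.sum_congr rfl fun ψ _ => ?_
  simp only [hfilter, mul_ite, mul_zero, Finset.sum_ite_eq', Finset.mem_univ, if_true]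
  rw [Finset.prod_comm]
  congr 1
  refine Finset.prod_congr rfl fun j _ => ?_
  simp [hε]

/-- The colour of the `i`-th occurrence of the endpoint `x` of the edge `e`, when internal half
edges are coloured by `χ` and open ends by `φ`. -/
def endColour {k : ℕ} (F : Fragment k) (φ : Fin k → Fin n) (χ : ∀ v, HalfEdges F v → Fin n)
    (e : Fin F.ne) (d : Σ x : Fin F.nv ⊕ Fin k, Fin ((F.inc e).count x)) : Fin n :=
  match d with
  | ⟨.inl v, i⟩ => χ v ⟨e, i⟩
  | ⟨.inr j, _⟩ => φ j

theorem tact_ph_eq_sum_halfEdges {g : Matrix (Fin n) (Fin n) 𝔽} {h : VertexModel 𝔽 n}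
    (hg : dualAct g.transpose h = h) {k : ℕ} (F : Fragment k) (φ : Fin k → Fin n) :
    tact g k (ph h F) φ = ∑ χ : ∀ v, HalfEdges F v → Fin n,
      (∏ e, ∑ c, ∏ d, g (endColour F φ χ e d) c) * ∏ v, h (∏ d, X (χ v d)) := by
  have hmon : ∀ ψ : Fin F.ne → Fin n, ∏ v, h (monomialAt F ψ v) =
      ∑ χ : ∀ v, HalfEdges F v → Fin n,
        (∏ v, ∏ d, g (χ v d) (ψ d.1)) * ∏ v, h (∏ d, X (χ v d)) := by
    intro ψ
    conv_lhs => rw [← hg]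
    simp only [monomialAt_eq_prod, dualAct_prod_X, Fintype.prod_sum, Finset.prod_mul_distrib,
      Matrix.transpose_apply]
  simp only [tact_ph_eq_sum_edge, hmon, Finset.mul_sum]
  rw [Finset.sum_comm]
  refine Finset.sum_congr rfl fun χ _ => ?_
  rw [Fintype.prod_sum, Finset.sum_mul]
  refine Finset.sum_congr rfl fun ψ _ => ?_
  rw [← mul_assoc]
  congr 1
  simp only [Fintype.prod_sigma, Fintype.prod_sum_type, endColour, Finset.prod_mul_distrib,
    Finset.prod_const, Finset.card_univ, Fintype.card_fin]
  rw [mul_comm, Finset.prod_comm]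

/-- The contribution of an edge with zero or two ends is the same for all orthogonal matrices. -/
theorem sum_prod_eq_of_mul_transpose {g : Matrix (Fin n) (Fin n) 𝔽} (hg : g * g.transpose = 1)
    {ι : Type} [Fintype ι] (hι : Fintype.card ι = 2 ∨ Fintype.card ι = 0) (a : ι → Fin n) :
    ∑ c, ∏ d, g (a d) c = ∑ c, ∏ d, (1 : Matrix (Fin n) (Fin n) 𝔽) (a d) c := by
  rcases hι with hι | hι
  · let q := (Fintype.equivFinOfCardEq hι).symm
    have key : ∀ m : Matrix (Fin n) (Fin n) 𝔽,
        ∑ c, ∏ d, m (a d) c = (m * m.transpose) (a (q 0)) (a (q 1)) := fun m => by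
      simp only [Matrix.mul_apply, Matrix.transpose_apply]
      refine Finset.sum_congr rfl fun c _ => ?_
      rw [← q.prod_comp, Fin.prod_univ_two]
    rw [key, key, hg, Matrix.transpose_one, one_mul]
  · have := Fintype.card_eq_zero_iff.mp hι
    simp

theorem tact_ph_of_mem_Stab {g : Matrix (Fin n) (Fin n) 𝔽} {h : VertexModel 𝔽 n}
    (hg : g ∈ Stab h) {k : ℕ} (F : Fragment k) : tact g k (ph h F) = ph h F := by
  have h1 : dualAct (1 : Matrix (Fin n) (Fin n) 𝔽).transpose h = h :=
    dualAct_transpose_eq ⟨by simp [orthSet], vertexModel_ext fun k φ => by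
      have := tact_one k fun ψ : Fin k → Fin n => h (∏ i, X (ψ i))
      rw [dualAct_prod_X]
      exact congrFun this φ⟩
  conv_rhs => rw [← tact_one k (ph h F)]
  funext φ
  rw [tact_ph_eq_sum_halfEdges (dualAct_transpose_eq hg), tact_ph_eq_sum_halfEdges h1]
  refine Finset.sum_congr rfl fun χ _ => ?_
  congr 1
  refine Finset.prod_congr rfl fun e _ => sum_prod_eq_of_mul_transpose
    (mul_eq_one_comm.mp hg.1) ?_ _
  have hcard : Fintype.card (Σ x : Fin F.nv ⊕ Fin k, Fin ((F.inc e).count x)) =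
      Multiset.card (F.inc e) := by
    rw [Fintype.card_sigma]
    simp only [Fintype.card_fin]
    exact Multiset.sum_count_eq_card fun x _ => Finset.mem_univ x
  rw [hcard]
  exact F.card_inc e

end VertexModels

/-- **Proposition 11**: `Stab(h)` equals the pointwise stabilizer of
`p_h(𝒜)`, i.e. of all tensors `p_h(F)` for fragments `F`. -/
theorem stab_eq_pointwise_stab_ph (𝔽 : Type) [Field 𝔽] (n : ℕ) (h : VertexModel 𝔽 n) :
    Stab h = {g | g ∈ orthSet 𝔽 n ∧
      ∀ (k : ℕ) (F : Fragment k), tact g k (ph h F) = ph h F} := by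
  ext g
  constructor
  · intro hg
    exact ⟨hg.1, fun k F => tact_ph_of_mem_Stab hg F⟩
  · rintro ⟨ho, hF⟩
    refine ⟨ho, vertexModel_ext fun k φ => ?_⟩
    have := congrFun (hF k (basicFragment k)) φ
    simp only [tact_apply, ph, hphi_basicFragment] at this
    rw [dualAct_prod_X]
    exact this
end

section
/- If the vertex model h ∈ R* is nondegenerate, then for every k ∈ ℕ the rank of the edge connection matrix M_{f_h,k} equals the dimension of p_h(𝒜) ∩ V^{⊗k}, i.e., of the span of {p_h(F) : F ∈ ℱ_k} in V^{⊗k}. -/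
/-!
Formalization framework for "Partition functions of vertex models /
edge connection matrices" (Regts–Draisma style).

Graphs and fragments are finite multigraphs (allowing multiple edges, loops
and circles); a `k`-fragment additionally has `k` labelled open ends.  We
encode a `k`-fragment by a number `nv` of internal vertices, a number `ne`
of edges, and for each edge the multiset of its endpoints, each endpoint
being either an internal vertex (`Sum.inl`) or an open-end label
(`Sum.inr`).  Every edge has `2` endpoints (counted with multiplicity; a
loop at `v` lists `v` twice) or `0` endpoints (a circle), and every label
occurs exactly once in total (the open ends have degree one).
-/

open MvPolynomial

open VertexModels

/-- Linear maps with the same kernel have ranges of the same dimension. -/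
lemma LinearMap.finrank_range_eq_of_ker_eq {K M N P : Type*} [Field K]
    [AddCommGroup M] [Module K M] [AddCommGroup N] [Module K N] [AddCommGroup P] [Module K P]
    {f : M →ₗ[K] N} {g : M →ₗ[K] P} (hfg : LinearMap.ker f = LinearMap.ker g) :
    Module.finrank K (LinearMap.range f) = Module.finrank K (LinearMap.range g) :=
  (f.quotKerEquivRange.symm.trans
    ((Submodule.quotEquivOfEq _ _ hfg).trans g.quotKerEquivRange)).finrank_eq

/-- Equation (12): for a nondegenerate vertex model `h`,
`rk(M_{f_h,k}) = dim (p_h(𝒜) ∩ V^{⊗k})`, the dimension of the span of the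
tensors `p_h(F)` for `k`-fragments `F`. -/
theorem rank_eq_finrank_span_ph (𝔽 : Type) [Field 𝔽] (n : ℕ) (h : VertexModel 𝔽 n)
    (hnd : Nondeg h) (k : ℕ) :
    connectionRank h k
      = Module.finrank 𝔽 (Submodule.span 𝔽
          (Set.range fun F : Fragment k => ph h F)) := by
  have hker : LinearMap.ker (glueRow h k) = LinearMap.ker (phL h k) := by
    ext γ
    exact (hnd k γ).symm
  have hrank := LinearMap.finrank_range_eq_of_ker_eq hker
  rwa [glueRow, phL, Finsupp.range_linearCombination, Finsupp.range_linearCombination] at hrank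
end
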